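/- Let f₀ = f_{α,s₁,s₂} ∈ F¹ be a log-concave density on ℝ whose logarithm is affine on its support interval, i.e., f_{α,s₁,s₂}(x) = (s₂−s₁)^{-1} 1{x ∈ [s₁,s₂]} if α = 0, and f_{α,s₁,s₂}(x) = α (e^{αs₂} − e^{αs₁})^{-1} e^{αx} 1{x ∈ [s₁,s₂]} if α ≠ 0 (allowing s₁ = −∞ when α > 0 and s₂ = ∞ when α < 0). Let X₁, …, X_n be i.i.d. with density f₀, n ≥ 5, and let f̂_n denote the log-concave maximum likelihood estimator. Then, writing κ* := α(s₂ − s₁) ∈ [−∞, ∞] and defining ρ : ℝ → (0,∞) by ρ(x) = (2e^x(x−1) − x² + 2)/(2e^x − 2 − 2x − x²) for x ≠ 0 and ρ(0) = 2, extended by ρ(∞) := ∞, we have E_{f₀} d_TV(f̂_n, f₀) ≤ min{2ρ(|κ*|), 6 log n} / n^{1/2}. -/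

import Mathlib

open MeasureTheory Filter Set
open scoped ENNReal Topology

noncomputable section

/-- `ℝ^d` with its Euclidean norm and Lebesgue measure. -/
abbrev Rd (d : ℕ) : Type := EuclideanSpace ℝ (Fin d)

/-- A nonnegative function is log-concave (`log f` is concave, with `log 0 := -∞`),
expressed multiplicatively via `f x ^ (1-t) * f y ^ t ≤ f ((1-t) • x + t • y)`. -/
def IsLogConcaveFn {E : Type*} [AddCommGroup E] [Module ℝ E] (f : E → ℝ) : Prop :=
  (∀ x, 0 ≤ f x) ∧
  ∀ x y : E, ∀ t : ℝ, t ∈ Set.Icc (0:ℝ) 1 →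
    f x ^ (1 - t) * f y ^ t ≤ f ((1 - t) • x + t • y)

/-- A probability density with respect to the (Lebesgue) measure of a `MeasureSpace`. -/
def IsDensity {E : Type*} [MeasureSpace E] (f : E → ℝ) : Prop :=
  (∀ x, 0 ≤ f x) ∧ Measurable f ∧ ∫⁻ x, ENNReal.ofReal (f x) = 1

/-- Membership in the class `F_d`: an upper semi-continuous log-concave probability
density. -/
def IsLCDensity {E : Type*} [MeasureSpace E] [TopologicalSpace E] [AddCommGroup E]
    [Module ℝ E] (f : E → ℝ) : Prop :=
  IsDensity f ∧ UpperSemicontinuous f ∧ IsLogConcaveFn f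

/-- Membership in the class `P_d`: probability measures with finite first moment that are
not concentrated on any affine hyperplane `{x | l x = c}` (`l` a nonzero linear
functional). -/
def MemP {E : Type*} [NormedAddCommGroup E] [NormedSpace ℝ E] [MeasureSpace E]
    (P : Measure E) : Prop :=
  IsProbabilityMeasure P ∧ Integrable (fun x => ‖x‖) P ∧
  ∀ (l : E →ₗ[ℝ] ℝ) (c : ℝ), l ≠ 0 → P {x | l x = c} < 1

/-- The log-concave projection predicate: `fs ∈ F_d` maximises `∫ log f dP` over `F_d`
(candidates whose objective is `-∞`, i.e. that vanish on a set of positive `P`-measure or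
have non-integrable logarithm, are trivially dominated). -/
def IsLCProj {E : Type*} [NormedAddCommGroup E] [NormedSpace ℝ E] [MeasureSpace E]
    (P : Measure E) (fs : E → ℝ) : Prop :=
  IsLCDensity fs ∧ (∀ᵐ x ∂P, 0 < fs x) ∧ Integrable (fun x => Real.log (fs x)) P ∧
  ∀ g : E → ℝ, IsLCDensity g → (∀ᵐ x ∂P, 0 < g x) →
    Integrable (fun x => Real.log (g x)) P →
    ∫ x, Real.log (g x) ∂P ≤ ∫ x, Real.log (fs x) ∂P

/-- `log y` with values in `[-∞, ∞)`, with the convention `log 0 := -∞`. -/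
def elog (y : ℝ) : EReal := if y ≤ 0 then ⊥ else ((Real.log y : ℝ) : EReal)

/-- Positive part of an extended real number, as an `ℝ≥0∞`. -/
def epos (a : EReal) : ℝ≥0∞ := if a = ⊤ then ⊤ else ENNReal.ofReal a.toReal

/-- `e^a` for an extended real `a`, valued in `[0,∞]`. -/
def expE (a : EReal) : ℝ≥0∞ :=
  if a = ⊥ then 0 else if a = ⊤ then ⊤ else ENNReal.ofReal (Real.exp a.toReal)

/-- Integral of an `EReal`-valued function: positive part minus negative part. -/
def erealIntegral {α : Type*} [MeasurableSpace α] (P : Measure α) (φ : α → EReal) : EReal :=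
  ((∫⁻ x, epos (φ x) ∂P : ℝ≥0∞) : EReal) - ((∫⁻ x, epos (-(φ x)) ∂P : ℝ≥0∞) : EReal)

/-- The class `Φ`: upper semi-continuous, concave functions `φ : E → [-∞, ∞)` with
`φ(x) → -∞` as `‖x‖ → ∞`. -/
def MemPhi {E : Type*} [NormedAddCommGroup E] [NormedSpace ℝ E] (φ : E → EReal) : Prop :=
  (∀ x, φ x ≠ ⊤) ∧ UpperSemicontinuous φ ∧
  (∀ x y : E, ∀ t : ℝ, t ∈ Set.Icc (0:ℝ) 1 →
    (((1 - t : ℝ)) : EReal) * φ x + ((t : ℝ) : EReal) * φ y ≤ φ ((1 - t) • x + t • y)) ∧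
  Tendsto φ (Filter.comap (fun x => ‖x‖) Filter.atTop) (nhds ⊥)

/-- The functional `L(φ, P) = ∫ φ dP - ∫ e^φ dx`. -/
def Lfun {E : Type*} [NormedAddCommGroup E] [NormedSpace ℝ E] [MeasureSpace E]
    (φ : E → EReal) (P : Measure E) : EReal :=
  erealIntegral P φ - ((∫⁻ x, expE (φ x) : ℝ≥0∞) : EReal)

/-- `L*(P) = sup_{φ ∈ Φ} L(φ, P)`. -/
def Lstar {E : Type*} [NormedAddCommGroup E] [NormedSpace ℝ E] [MeasureSpace E]
    (P : Measure E) : EReal :=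
  ⨆ (φ : E → EReal) (_ : MemPhi φ), Lfun φ P

/-- Action of a matrix on a Euclidean vector. -/
def mulVE {m d : ℕ} (A : Matrix (Fin m) (Fin d) ℝ) (x : Rd d) : Rd m :=
  (WithLp.equiv 2 (Fin m → ℝ)).symm (A.mulVec ((WithLp.equiv 2 (Fin d → ℝ)) x))

open scoped Classical

/-- The function `ρ` of Kim, Guntuboyina and Samworth (2016). -/
def rhoFn (x : ℝ) : ℝ :=
  if x = 0 then 2
  else (2 * Real.exp x * (x - 1) - x ^ 2 + 2) / (2 * Real.exp x - 2 - 2 * x - x ^ 2)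

/-- `g` is a log-concave maximum likelihood estimator for the data `xs` on `ℝ`. -/
def IsMLE1 {n : ℕ} (xs : Fin n → ℝ) (g : ℝ → ℝ) : Prop :=
  IsLCDensity g ∧ ∀ h : ℝ → ℝ, IsLCDensity h →
    (∑ i, elog (h (xs i))) ≤ ∑ i, elog (g (xs i))

/-- The bound `min{2ρ(|κ*|), 6 log n}`, where `|κ*| = |α|(s₂ - s₁) ∈ [0, ∞]` and
`ρ(∞) := ∞`. -/
def bound18 (α : ℝ) (s₁ s₂ : EReal) (n : ℕ) : ℝ :=
  if ((|α| : ℝ) : EReal) * (s₂ - s₁) = ⊤ then 6 * Real.log n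
  else min (2 * rhoFn ((((|α| : ℝ) : EReal) * (s₂ - s₁)).toReal)) (6 * Real.log n)


/-- Partial sums of a real sequence. -/
def walk (x : ℕ → ℝ) (k : ℕ) : ℝ := ∑ i ∈ Finset.range k, x i

/-- Running maximum `max(0, S₁, …, S_j)` of the partial sums of a real sequence. -/
def runMax (x : ℕ → ℝ) : ℕ → ℝ
  | 0 => 0
  | j + 1 => max (runMax x j) (walk x (j + 1))

/-- Cyclic rotation of the first `j + 1` coordinates. -/
def rot (j : ℕ) (x : ℕ → ℝ) (k : ℕ) : ℝ :=
  if k < j then x (k + 1) else if k = j then x 0 else x k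

lemma walk_zero (x : ℕ → ℝ) : walk x 0 = 0 := by simp [walk]

lemma walk_succ (x : ℕ → ℝ) (k : ℕ) : walk x (k + 1) = walk x k + x k := by
  simp [walk, Finset.sum_range_succ]

lemma walk_succ' (x : ℕ → ℝ) (k : ℕ) :
    walk x (k + 1) = x 0 + walk (fun i => x (i + 1)) k := by
  simp [walk, Finset.sum_range_succ', add_comm]

lemma walk_neg (x : ℕ → ℝ) (k : ℕ) : walk (-x) k = -walk x k := by simp [walk]

lemma runMax_nonneg (x : ℕ → ℝ) (j : ℕ) : 0 ≤ runMax x j := by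
  induction j with
  | zero => exact le_rfl
  | succ j ih => exact le_max_of_le_left ih

lemma walk_le_runMax (x : ℕ → ℝ) {k j : ℕ} (h : k ≤ j) : walk x k ≤ runMax x j := by
  induction j with
  | zero =>
    obtain rfl : k = 0 := by omega
    simp [walk_zero, runMax]
  | succ j ih =>
    rcases Nat.lt_or_ge k (j + 1) with h' | h'
    · exact le_max_of_le_left (ih (by omega))
    · obtain rfl : k = j + 1 := by omega
      exact le_max_right _ _

lemma runMax_succ' (x : ℕ → ℝ) (j : ℕ) :
    runMax x (j + 1) = max 0 (x 0 + runMax (fun i => x (i + 1)) j) := by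
  induction j with
  | zero => simp [runMax, walk]
  | succ j ih =>
    rw [runMax, ih, walk_succ', runMax, ← max_add_add_left, max_assoc]

lemma walk_congr {x y : ℕ → ℝ} {j : ℕ} (h : ∀ k < j, x k = y k) : walk x j = walk y j :=
  Finset.sum_congr rfl fun k hk => h k (Finset.mem_range.1 hk)

lemma runMax_congr {x y : ℕ → ℝ} {j : ℕ} (h : ∀ k < j, x k = y k) :
    runMax x j = runMax y j := by
  induction j with
  | zero => rfl
  | succ j ih =>
    rw [runMax, runMax, ih fun k hk => h k (by omega), walk_congr h]

lemma walk_rot (x : ℕ → ℝ) (j : ℕ) : walk (rot j x) (j + 1) = walk x (j + 1) := by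
  rw [walk_succ, walk_succ', walk_congr (y := fun i => x (i + 1))]
  · simp [rot, add_comm]
  · intro k hk
    simp [rot, hk]

lemma runMax_succ_eq (x : ℕ → ℝ) (j : ℕ) :
    runMax x (j + 1) =
      (if 0 < walk x (j + 1) then x 0 else 0) +
      ((if 0 < walk (rot j x) (j + 1) then runMax (rot j x) j else 0) +
        (if 0 < walk x (j + 1) then 0 else runMax x j)) := by
  rw [walk_rot]
  split_ifs with h
  · have h1 : runMax (rot j x) j = runMax (fun i => x (i + 1)) j :=
      runMax_congr fun k hk => by simp [rot, hk]
    have h2 := runMax_succ' x j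
    have h3 := walk_le_runMax x (le_refl (j + 1))
    rcases max_choice 0 (x 0 + runMax (fun i => x (i + 1)) j) with h4 | h4
    · rw [h4] at h2; linarith
    · rw [h2, h4, h1]; ring
  · rw [runMax, max_eq_left ((not_lt.1 h).trans (runMax_nonneg x j))]; ring

section Spitzer

variable {Ω : Type*} [Finite Ω] [MeasurableSpace Ω] [MeasurableSingletonClass Ω]

lemma integral_indicator_first (μ : Measure Ω) [IsFiniteMeasure μ] (x : Ω → ℕ → ℝ) (j : ℕ)
    (hrot : ∀ Φ : (ℕ → ℝ) → ℝ, ∫ ω, Φ (rot j (x ω)) ∂μ = ∫ ω, Φ (x ω) ∂μ) :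
    ∫ ω, (if 0 < walk (x ω) (j + 1) then x ω 0 else 0) ∂μ =
      (1 / ((j : ℝ) + 1)) * ∫ ω, max (walk (x ω) (j + 1)) 0 ∂μ := by
  have hk : ∀ k ≤ j, ∫ ω, (if 0 < walk (x ω) (j + 1) then x ω k else 0) ∂μ =
      ∫ ω, (if 0 < walk (x ω) (j + 1) then x ω 0 else 0) ∂μ := by
    intro k
    induction k with
    | zero => intro _; rfl
    | succ k ih =>
      intro hk
      rw [← ih (by omega),
        ← hrot fun y => if 0 < walk y (j + 1) then y k else 0]
      refine integral_congr_ae (.of_forall fun ω => ?_)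
      have : k < j := by omega
      simp [walk_rot, rot, this]
  have hsum : ∫ ω, max (walk (x ω) (j + 1)) 0 ∂μ =
      ∑ k ∈ Finset.range (j + 1), ∫ ω, (if 0 < walk (x ω) (j + 1) then x ω k else 0) ∂μ := by
    rw [← integral_finsetSum _ fun _ _ => Integrable.of_finite]
    refine integral_congr_ae (.of_forall fun ω => ?_)
    dsimp only
    split_ifs with h
    · rw [max_eq_left h.le]; rfl
    · simp [max_eq_right (not_lt.1 h)]
  rw [hsum, Finset.sum_congr rfl fun k hk' => hk k (by simpa [Nat.lt_succ_iff] using hk')]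
  rw [Finset.sum_const, Finset.card_range, nsmul_eq_mul]
  push_cast
  field_simp

/-- Spitzer's identity for rotation-invariant increments. -/
lemma integral_runMax (μ : Measure Ω) [IsFiniteMeasure μ] (x : Ω → ℕ → ℝ) (m : ℕ)
    (hrot : ∀ j < m, ∀ Φ : (ℕ → ℝ) → ℝ, ∫ ω, Φ (rot j (x ω)) ∂μ = ∫ ω, Φ (x ω) ∂μ) :
    ∫ ω, runMax (x ω) m ∂μ =
      ∑ j ∈ Finset.range m, (1 / ((j : ℝ) + 1)) * ∫ ω, max (walk (x ω) (j + 1)) 0 ∂μ := by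
  induction m with
  | zero => simp [runMax]
  | succ m ih =>
    rw [Finset.sum_range_succ, ← ih fun j hj => hrot j (by omega),
      ← integral_indicator_first μ x m (hrot m (by omega)),
      integral_congr_ae (.of_forall fun ω => runMax_succ_eq (x ω) m),
      integral_add .of_finite .of_finite, integral_add .of_finite .of_finite,
      hrot m (by omega) fun y => if 0 < walk y (m + 1) then runMax y m else 0,
      ← integral_add .of_finite .of_finite, add_comm]
    congr 1
    refine integral_congr_ae (.of_forall fun ω => ?_)
    dsimp only
    split_ifs <;> simp

end Spitzer

lemma sum_inv_sqrt_le (m : ℕ) :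
    ∑ j ∈ Finset.range m, 1 / √((j : ℝ) + 1) ≤ 2 * √m := by
  induction m with
  | zero => simp
  | succ m ih =>
    rw [Finset.sum_range_succ]
    have h0 : (0 : ℝ) ≤ m := by positivity
    have h1 := Real.sq_sqrt h0
    have h2 := Real.sq_sqrt (by positivity : (0 : ℝ) ≤ m + 1)
    have h3 : 0 < √((m : ℝ) + 1) := by positivity
    have h4 := Real.sqrt_nonneg (m : ℝ)
    have : 1 / √((m : ℝ) + 1) ≤ 2 * √((m : ℝ) + 1) - 2 * √m := by
      rw [div_le_iff₀ h3]
      nlinarith [sq_nonneg (√((m : ℝ) + 1) - √m)]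
    push_cast
    linarith

/-- Centred bin frequencies of a sample `ω` of `n` bin labels among `m` bins. -/
def incr {n m : ℕ} (ω : Fin n → Fin m) (k : ℕ) : ℝ :=
  (1 / (n : ℝ)) * ∑ i, ((if (ω i : ℕ) = k then 1 else 0) - 1 / (m : ℝ))

lemma walk_incr {n m : ℕ} (ω : Fin n → Fin m) (k : ℕ) :
    walk (incr ω) k =
      (1 / (n : ℝ)) * ∑ i, ((if (ω i : ℕ) < k then 1 else 0) - (k : ℝ) / m) := by
  simp only [walk, incr]
  rw [← Finset.mul_sum, Finset.sum_comm]
  congr 1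
  refine Finset.sum_congr rfl fun i _ => ?_
  rw [Finset.sum_sub_distrib, Finset.sum_const, Finset.sum_ite_eq]
  simp [div_eq_mul_inv]

lemma incr_rot {n m : ℕ} (ω : Fin n → Fin m) (j : Fin m) :
    incr (fun i => (Fin.cycleRange j).symm (ω i)) = rot j (incr ω) := by
  have : NeZero m := ⟨by have := j.2; omega⟩
  have key : ∀ (a : Fin m) (k : ℕ), ((Fin.cycleRange j).symm a : ℕ) = k ↔
      (a : ℕ) = (if k < (j : ℕ) then k + 1 else if k = j then 0 else k) := by
    intro a k
    rcases Nat.lt_or_ge k m with hk | hk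
    · have h1 : ((Fin.cycleRange j).symm a : ℕ) = k ↔ a = Fin.cycleRange j ⟨k, hk⟩ := by
        rw [← Equiv.symm_apply_eq, Fin.ext_iff]
      rw [h1, Fin.ext_iff]
      split_ifs with h2 h3
      · rw [Fin.coe_cycleRange_of_lt (by simpa [Fin.lt_def] using h2)]
      · have : (⟨k, hk⟩ : Fin m) = j := Fin.ext h3
        rw [this, Fin.cycleRange_self]; simp
      · rw [Fin.cycleRange_of_gt (by rw [Fin.lt_def]; simp; omega)]
    · have h1 := ((Fin.cycleRange j).symm a).2
      have h2 := a.2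
      have h3 := j.2
      constructor
      · intro h; omega
      · split_ifs <;> intro h <;> omega
  funext k
  simp only [rot, incr, key]
  split_ifs <;> rfl

section BinMeasure

variable {n m : ℕ} (ν : Measure (Fin m))

lemma measurePreserving_perm (hν : ∀ k, ν {k} = (m : ℝ≥0∞)⁻¹) (e : Equiv.Perm (Fin m)) :
    MeasurePreserving e ν ν := by
  refine ⟨measurable_of_finite _, Measure.ext_of_singleton fun k => ?_⟩
  rw [Measure.map_apply (measurable_of_finite _) (measurableSet_singleton k)]
  have : e ⁻¹' {k} = {e.symm k} := by
    ext a; simp [Equiv.eq_symm_apply]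
  rw [this, hν, hν]

variable [IsProbabilityMeasure ν]

lemma integral_rot_incr (hν : ∀ k, ν {k} = (m : ℝ≥0∞)⁻¹) (Φ : (ℕ → ℝ) → ℝ) {j : ℕ}
    (hj : j < m) :
    ∫ ω, Φ (rot j (incr ω)) ∂(Measure.pi fun _ : Fin n => ν) =
      ∫ ω, Φ (incr ω) ∂(Measure.pi fun _ : Fin n => ν) := by
  have h := measurePreserving_pi (fun _ : Fin n => ν) (fun _ => ν)
    (fun _ => measurePreserving_perm ν hν (Fin.cycleRange ⟨j, hj⟩).symm)
  symm
  rw [← h.map_eq, integral_map h.measurable.aemeasurable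
    (measurable_of_finite _).aestronglyMeasurable, h.map_eq]
  refine integral_congr_ae (.of_forall fun ω => ?_)
  simp only [incr_rot]

lemma sum_fin_ite_lt {k : ℕ} (hk : k ≤ m) (c d : ℝ) :
    ∑ a : Fin m, (if (a : ℕ) < k then c else d) = k * c + (m - k) * d := by
  rw [Fin.sum_univ_eq_sum_range (fun a => if a < k then c else d) m,
    ← Finset.sum_range_add_sum_Ico _ hk,
    Finset.sum_congr rfl (fun a ha => if_pos (Finset.mem_range.1 ha)),
    Finset.sum_congr rfl (fun a ha => if_neg (not_lt.2 (Finset.mem_Ico.1 ha).1))]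
  simp [Nat.cast_sub hk]

lemma integral_walk_incr_sq (hν : ∀ k, ν {k} = (m : ℝ≥0∞)⁻¹) (hn : 0 < n) (hm : 0 < m)
    {k : ℕ} (hk : k ≤ m) :
    ∫ ω, (walk (incr ω) k) ^ 2 ∂(Measure.pi fun _ : Fin n => ν) ≤ (k : ℝ) / (m * n) ∧
    ∫ ω, walk (incr ω) k ∂(Measure.pi fun _ : Fin n => ν) = 0 := by
  set Y : Fin m → ℝ := fun a => (if (a : ℕ) < k then 1 else 0) - (k : ℝ) / m with hY
  have hm' : (0 : ℝ) < m := by positivity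
  have hn' : (0 : ℝ) < n := by positivity
  have h_int : ∀ c d : ℝ, ∫ a : Fin m, (if (a : ℕ) < k then c else d) ∂ν =
      (1 / m) * (k * c + (m - k) * d) := by
    intro c d
    rw [integral_fintype .of_finite, ← sum_fin_ite_lt hk, Finset.mul_sum]
    refine Finset.sum_congr rfl fun a _ => ?_
    rw [measureReal_def, hν]
    simp
  have hY0 : ∫ a, Y a ∂ν = 0 := by
    have : Y = fun a : Fin m => if (a : ℕ) < k then 1 - (k : ℝ) / m else -((k : ℝ) / m) := by
      funext a; simp only [hY]; split_ifs <;> ring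
    rw [this, h_int]; field_simp; ring
  have hY2 : ∫ a, Y a ^ 2 ∂ν ≤ k / m := by
    have : (fun a => Y a ^ 2) = fun a : Fin m =>
        if (a : ℕ) < k then (1 - (k : ℝ) / m) ^ 2 else ((k : ℝ) / m) ^ 2 := by
      funext a; simp only [hY]; split_ifs <;> ring
    rw [this, h_int]
    have : 1 / (m : ℝ) * (k * (1 - (k : ℝ) / m) ^ 2 + (m - k) * ((k : ℝ) / m) ^ 2) =
        k / m - (k / m) ^ 2 := by
      field_simp; ring
    rw [this]
    nlinarith [sq_nonneg ((k : ℝ) / m)]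
  have hw : ∀ ω : Fin n → Fin m, walk (incr ω) k = (1 / (n : ℝ)) * ∑ i, Y (ω i) :=
    fun ω => walk_incr ω k
  have hcoord : ∀ i : Fin n, ∫ ω, Y (ω i) ∂(Measure.pi fun _ : Fin n => ν) = 0 := by
    intro i
    have h := measurePreserving_eval (fun _ : Fin n => ν) i
    rw [← hY0]
    conv_rhs => rw [← h.map_eq]
    rw [integral_map h.measurable.aemeasurable (measurable_of_finite _).aestronglyMeasurable]
  have hmean : ∫ ω, ∑ i, Y (ω i) ∂(Measure.pi fun _ : Fin n => ν) = 0 := by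
    rw [integral_finsetSum _ fun _ _ => Integrable.of_finite]
    exact Finset.sum_eq_zero fun i _ => hcoord i
  simp_rw [hw]
  refine ⟨?_, by rw [integral_const_mul, hmean, mul_zero]⟩
  have hvar := ProbabilityTheory.variance_sum_pi (μ := fun _ : Fin n => ν)
    (X := fun _ => Y) (fun _ => .of_discrete)
  have hvarY : ProbabilityTheory.variance Y ν ≤ k / m := by
    rw [ProbabilityTheory.variance_eq_sub .of_discrete, hY0]
    simpa using hY2
  rw [ProbabilityTheory.variance_eq_sub .of_discrete] at hvar
  simp only [Pi.pow_apply, Finset.sum_apply, hmean] at hvar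
  simp_rw [mul_pow]
  rw [integral_const_mul]
  have : ∫ ω, (∑ i, Y (ω i)) ^ 2 ∂(Measure.pi fun _ : Fin n => ν) ≤ n * (k / m) := by
    have h2 : ∑ _i : Fin n, ProbabilityTheory.variance Y ν ≤ n * (k / m) := by
      rw [Finset.sum_const, Finset.card_univ, Fintype.card_fin, nsmul_eq_mul]
      gcongr
    linarith
  calc _ ≤ (1 / (n : ℝ)) ^ 2 * (n * (k / m)) := by gcongr
    _ = _ := by field_simp

lemma integral_posPart_le {Ω : Type*} [Finite Ω] [MeasurableSpace Ω]
    [MeasurableSingletonClass Ω] (μ : Measure Ω) [IsProbabilityMeasure μ] (f : Ω → ℝ)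
    (h0 : ∫ ω, f ω ∂μ = 0) {v : ℝ} (hv : ∫ ω, f ω ^ 2 ∂μ ≤ v) :
    ∫ ω, max (f ω) 0 ∂μ ≤ (1 / 2) * √v := by
  have habs : ∫ ω, |f ω| ∂μ ≤ √v := by
    apply Real.le_sqrt_of_sq_le
    refine le_trans ?_ hv
    have h := ProbabilityTheory.variance_nonneg (fun ω => |f ω|) μ
    rw [ProbabilityTheory.variance_eq_sub .of_discrete] at h
    simpa using h
  have : ∀ ω, max (f ω) 0 = (1 / 2) * (|f ω| + f ω) := by
    intro ω
    rcases le_total 0 (f ω) with h | h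
    · rw [max_eq_left h, abs_of_nonneg h]; ring
    · rw [max_eq_right h, abs_of_nonpos h]; ring
  simp_rw [this]
  rw [integral_const_mul, integral_add .of_finite .of_finite, h0, add_zero]
  linarith

lemma sum_sqrt_bound (hn : 0 < n) (hm : 0 < m) :
    ∑ j ∈ Finset.range m, (1 / ((j : ℝ) + 1)) *
      ((1 / 2) * √(((j + 1 : ℕ) : ℝ) / (m * n))) ≤ 1 / √n := by
  have hn' : 0 < √(n : ℝ) := by positivity
  have hm' : 0 < √(m : ℝ) := by positivity
  have : ∀ j ∈ Finset.range m, (1 / ((j : ℝ) + 1)) *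
      ((1 / 2) * √(((j + 1 : ℕ) : ℝ) / (m * n))) =
      (1 / (2 * √m * √n)) * (1 / √((j : ℝ) + 1)) := by
    intro j _
    have h2 : 0 < √((j : ℝ) + 1) := by positivity
    have h3 := Real.sq_sqrt (by positivity : (0 : ℝ) ≤ j + 1)
    rw [Real.sqrt_div (by positivity), Real.sqrt_mul (by positivity)]
    push_cast
    nth_rewrite 1 [← h3]
    field_simp
  rw [Finset.sum_congr rfl this, ← Finset.mul_sum]
  calc _ ≤ (1 / (2 * √m * √n)) * (2 * √m) := by gcongr; exact sum_inv_sqrt_le m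
    _ = 1 / √n := by field_simp

lemma integral_runMax_incr_le (hν : ∀ k, ν {k} = (m : ℝ≥0∞)⁻¹) (hn : 0 < n) (hm : 0 < m) :
    ∫ ω, (runMax (incr ω) m + runMax (-incr ω) m) ∂(Measure.pi fun _ : Fin n => ν) ≤
      2 / √n := by
  have hneg : ∀ j (x : ℕ → ℝ), rot j (-x) = -rot j x := by
    intro j x; funext k; simp only [rot, Pi.neg_apply]; split_ifs <;> rfl
  rw [integral_add .of_finite .of_finite,
    integral_runMax _ _ m fun j hj Φ => integral_rot_incr ν hν Φ hj,
    integral_runMax _ (fun ω => -incr ω) m fun j hj Φ => by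
      simp only [hneg]
      exact integral_rot_incr ν hν (fun y => Φ (-y)) hj]
  have h1 := sum_sqrt_bound hn hm
  have h2 : ∀ j ∈ Finset.range m, (1 / ((j : ℝ) + 1)) *
      ∫ ω, max (walk (incr ω) (j + 1)) 0 ∂(Measure.pi fun _ : Fin n => ν) ≤
      (1 / ((j : ℝ) + 1)) * ((1 / 2) * √(((j + 1 : ℕ) : ℝ) / (m * n))) := by
    intro j hj
    have := integral_walk_incr_sq ν hν hn hm (k := j + 1) (by simpa using hj)
    have := integral_posPart_le _ _ this.2 this.1
    gcongr
  have h3 : ∀ j ∈ Finset.range m, (1 / ((j : ℝ) + 1)) *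
      ∫ ω, max (walk (-incr ω) (j + 1)) 0 ∂(Measure.pi fun _ : Fin n => ν) ≤
      (1 / ((j : ℝ) + 1)) * ((1 / 2) * √(((j + 1 : ℕ) : ℝ) / (m * n))) := by
    intro j hj
    have := integral_walk_incr_sq ν hν hn hm (k := j + 1) (by simpa using hj)
    have := integral_posPart_le (Measure.pi fun _ : Fin n => ν)
      (fun ω => walk (-incr ω) (j + 1)) (v := ((j + 1 : ℕ) : ℝ) / (m * n))
      (by simp [walk_neg, integral_neg, this.2])
      (by simpa [walk_neg] using this.1)
    gcongr
  have h4 := Finset.sum_le_sum h2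
  have h5 := Finset.sum_le_sum h3
  calc _ ≤ 1 / √(n : ℝ) + 1 / √(n : ℝ) := by gcongr <;> linarith
    _ = _ := by ring

end BinMeasure

lemma continuous_cdf_of_nullSingletonClass (μ : Measure ℝ) [IsProbabilityMeasure μ]
    [NullSingletonClass μ] :
    Continuous (ProbabilityTheory.cdf μ) := by
  rw [continuous_iff_continuousAt]
  intro a
  rw [(ProbabilityTheory.cdf μ).mono.continuousAt_iff_leftLim_eq_rightLim,
    StieltjesFunction.rightLim_eq]
  have h := (ProbabilityTheory.cdf μ).measure_singleton a
  rw [ProbabilityTheory.measure_cdf, measure_singleton, eq_comm, ENNReal.ofReal_eq_zero] at h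
  exact le_antisymm ((ProbabilityTheory.cdf μ).mono.leftLim_le le_rfl) (by linarith)

lemma exists_quantile (μ : Measure ℝ) [IsProbabilityMeasure μ] [NullSingletonClass μ] {q : ℝ}
    (h0 : 0 < q) (h1 : q < 1) : ∃ t, μ.real (Iic t) = q := by
  have hb := ProbabilityTheory.tendsto_cdf_atBot μ
  have ht := ProbabilityTheory.tendsto_cdf_atTop μ
  obtain ⟨t, ht⟩ := mem_range_of_exists_le_of_exists_ge (continuous_cdf_of_nullSingletonClass μ)
    ((hb.eventually_lt_const h0).exists.imp fun _ h => h.le)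
    ((ht.eventually_const_lt h1).exists.imp fun _ h => h.le)
  exact ⟨t, by rw [← ht, ProbabilityTheory.cdf_eq_real]⟩

/-- An atomless probability measure on `ℝ` can be cut into `m` consecutive bins of equal mass. -/
lemma exists_bins (μ : Measure ℝ) [IsProbabilityMeasure μ] [NullSingletonClass μ] {m : ℕ}
    (hm : 0 < m) :
    ∃ bin : ℝ → Fin m, Monotone bin ∧
      ∀ k ≤ m, μ.real {x | (bin x : ℕ) < k} = (k : ℝ) / m := by
  have hm' : (0 : ℝ) < m := by positivity
  have hex : ∀ k : ℕ, ∃ t, 1 ≤ k → k < m → μ.real (Iic t) = (k : ℝ) / m := by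
    intro k
    by_cases hk : 1 ≤ k ∧ k < m
    · obtain ⟨t, ht⟩ := exists_quantile μ (q := (k : ℝ) / m)
        (div_pos (by exact_mod_cast hk.1) hm') (by
          rw [div_lt_one hm']; exact_mod_cast hk.2)
      exact ⟨t, fun _ _ => ht⟩
    · exact ⟨0, fun h1 h2 => (hk ⟨h1, h2⟩).elim⟩
  choose t ht using hex
  have hmono : ∀ j k, 1 ≤ j → j ≤ k → k < m → t j ≤ t k := by
    intro j k hj hjk hk
    by_contra! hlt
    have h1 := ht j hj (by omega)
    have h2 := ht k (by omega) hk
    have h3 : μ.real (Iic (t k)) ≤ μ.real (Iic (t j)) :=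
      measureReal_mono (Iic_subset_Iic.2 hlt.le)
    rw [h1, h2, div_le_div_iff_of_pos_right hm'] at h3
    have h4 : k = j := le_antisymm (by exact_mod_cast h3) hjk
    rw [h4] at hlt
    exact lt_irrefl _ hlt
  set s : ℝ → Finset ℕ := fun x => (Finset.Ico 1 m).filter fun j => t j < x with hs
  have hcard : ∀ x, (s x).card < m := fun x =>
    (Finset.card_filter_le _ _).trans_lt (by simp; omega)
  refine ⟨fun x => ⟨(s x).card, hcard x⟩, fun x y hxy => ?_, fun k hk => ?_⟩
  · rw [Fin.mk_le_mk]
    refine Finset.card_le_card fun j hj => ?_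
    simp only [hs, Finset.mem_filter] at hj ⊢
    exact ⟨hj.1, hj.2.trans_le hxy⟩
  · rcases Nat.eq_zero_or_pos k with rfl | hk0
    · simp
    rcases hk.eq_or_lt with rfl | hkm
    · have : {x | (s x).card < k} = univ := eq_univ_of_forall hcard
      simp only [this, probReal_univ]
      field_simp
    have : {x | (s x).card < k} = Iic (t k) := by
      ext x
      simp only [mem_ofPred_eq, mem_Iic]
      constructor
      · intro h
        by_contra! hlt
        have hsub : Finset.Icc 1 k ⊆ s x := by
          intro j hj
          simp only [hs, Finset.mem_filter, Finset.mem_Ico, Finset.mem_Icc] at hj ⊢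
          exact ⟨⟨hj.1, by omega⟩, (hmono j k hj.1 hj.2 hkm).trans_lt hlt⟩
        have := Finset.card_le_card hsub
        simp at this
        omega
      · intro h
        have hsub : s x ⊆ Finset.Ico 1 k := by
          intro j hj
          simp only [hs, Finset.mem_filter, Finset.mem_Ico] at hj ⊢
          refine ⟨hj.1.1, ?_⟩
          by_contra! hkj
          exact absurd (h.trans (hmono k j hk0 hkj hj.1.2)) (not_le.2 hj.2)
        have := Finset.card_le_card hsub
        simp at this
        omega
    simp only [this]
    exact ht k hk0 hkm

lemma measure_bin_eq {μ : Measure ℝ} [IsProbabilityMeasure μ] {m : ℕ} (hm : 0 < m)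
    {bin : ℝ → Fin m} (hmono : Monotone bin)
    (hbin : ∀ k ≤ m, μ.real {x | (bin x : ℕ) < k} = (k : ℝ) / m) (k : Fin m) :
    μ.map bin {k} = (m : ℝ≥0∞)⁻¹ := by
  have hmeas := hmono.measurable
  have hlt : ∀ k : ℕ, MeasurableSet {x | (bin x : ℕ) < k} := fun k =>
    hmeas (MeasurableSet.of_discrete (s := {a : Fin m | (a : ℕ) < k}))
  rw [Measure.map_apply hmeas (measurableSet_singleton k)]
  have hset : bin ⁻¹' {k} = {x | (bin x : ℕ) < k + 1} \ {x | (bin x : ℕ) < k} := by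
    ext x
    simp only [mem_preimage, mem_singleton_iff, Set.mem_sdiff, mem_ofPred_eq, Fin.ext_iff]
    omega
  have h1 : μ.real (bin ⁻¹' {k}) = 1 / m := by
    rw [hset, measureReal_sdiff (fun x hx => by simp only [mem_ofPred_eq] at hx ⊢; omega) (hlt k),
      hbin _ (by have := k.2; omega), hbin _ k.2.le]
    push_cast
    ring
  rw [← ofReal_measureReal, h1, one_div, ENNReal.ofReal_inv_of_pos (by positivity),
    ENNReal.ofReal_natCast]

/-- Excess empirical mass of intervals, controlled by the binned empirical process. -/
lemma empirical_interval_le {μ : Measure ℝ} [IsProbabilityMeasure μ] {n m : ℕ} (hn : 0 < n)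
    (hm : 0 < m)
    {bin : ℝ → Fin m} (hmono : Monotone bin)
    (hbin : ∀ k ≤ m, μ.real {x | (bin x : ℕ) < k} = (k : ℝ) / m)
    (xs : Fin n → ℝ) {I : Set ℝ} (hI : I.OrdConnected) :
    (1 / (n : ℝ)) * ∑ i, (if xs i ∈ I then 1 else 0) ≤
      μ.real I + (runMax (incr (bin ∘ xs)) m + runMax (-incr (bin ∘ xs)) m + 2 / m) := by
  set x := incr (bin ∘ xs) with hx
  have hn' : (0 : ℝ) < n := by positivity
  have hm' : (0 : ℝ) < m := by positivity
  have hr1 := runMax_nonneg x m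
  have hr2 := runMax_nonneg (-x) m
  have hI0 : 0 ≤ μ.real I := measureReal_nonneg
  set T := Finset.univ.filter fun i => xs i ∈ I with hT
  rcases T.eq_empty_or_nonempty with hempty | hne
  · have : ∀ i, xs i ∉ I := fun i hi => by
      have : i ∈ T := by simp [hT, hi]
      simp [hempty] at this
    simp only [this, if_false, Finset.sum_const_zero, mul_zero]
    positivity
  obtain ⟨i₀, hi₀, hmin⟩ := T.exists_min_image xs hne
  obtain ⟨i₁, hi₁, hmax⟩ := T.exists_max_image xs hne
  simp only [hT, Finset.mem_filter, Finset.mem_univ, true_and] at hi₀ hi₁ hmin hmax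
  set a : ℕ := (bin (xs i₀)).val with ha
  set b : ℕ := (bin (xs i₁)).val with hb
  have hab : a ≤ b := hmono (hmin i₁ hi₁)
  have hbm : b < m := (bin (xs i₁)).2
  have hlow : ((b : ℝ) - a - 1) / m ≤ μ.real I := by
    rcases hab.eq_or_lt with h | h
    · refine le_trans ?_ hI0
      rw [h]
      apply div_nonpos_of_nonpos_of_nonneg <;> linarith
    have hmeas : MeasurableSet {x | (bin x : ℕ) < a + 1} :=
      hmono.measurable (MeasurableSet.of_discrete (s := {c : Fin m | (c : ℕ) < a + 1}))
    have hsub : {x | (bin x : ℕ) < b} \ {x | (bin x : ℕ) < a + 1} ⊆ I := by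
      rintro y ⟨hy1, hy2⟩
      simp only [mem_ofPred_eq, not_lt] at hy1 hy2
      refine hI.out hi₀ hi₁ ⟨?_, ?_⟩
      · by_contra! hlt
        have := hmono hlt.le
        rw [Fin.le_def] at this
        omega
      · by_contra! hlt
        have := hmono hlt.le
        rw [Fin.le_def] at this
        omega
    have h2 := measureReal_mono (μ := μ) hsub
    rw [measureReal_sdiff (fun x hx => by simp only [mem_ofPred_eq] at hx ⊢; omega) hmeas,
      hbin _ hbm.le, hbin _ (by omega)] at h2
    refine le_trans (le_of_eq ?_) h2
    push_cast
    ring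
  have hup : (1 / (n : ℝ)) * ∑ i, (if xs i ∈ I then (1 : ℝ) else 0) ≤
      walk x (b + 1) - walk x a + ((b : ℝ) + 1 - a) / m := by
    rw [hx, walk_incr, walk_incr, ← mul_sub, ← Finset.sum_sub_distrib]
    have : ((b : ℝ) + 1 - a) / m = (1 / (n : ℝ)) * ∑ _i : Fin n, ((b : ℝ) + 1 - a) / m := by
      rw [Finset.sum_const, Finset.card_univ, Fintype.card_fin, nsmul_eq_mul]
      field_simp
    rw [this, ← mul_add, ← Finset.sum_add_distrib]
    gcongr with i _
    have hle : (if xs i ∈ I then (1 : ℝ) else 0) ≤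
        (if ((bin ∘ xs) i : ℕ) < b + 1 then 1 else 0) -
          (if ((bin ∘ xs) i : ℕ) < a then 1 else 0) := by
      simp only [Function.comp]
      by_cases hi : xs i ∈ I
      · have h1 : a ≤ bin (xs i) := hmono (hmin i hi)
        have h2 : bin (xs i) ≤ b := hmono (hmax i hi)
        rw [if_pos hi, if_pos (by omega), if_neg (by omega)]
        norm_num
      · rw [if_neg hi]
        split_ifs <;> first | omega | norm_num
    refine hle.trans (le_of_eq ?_)
    push_cast
    ring
  have h1 := walk_le_runMax x (show b + 1 ≤ m from hbm)
  have h2 := walk_le_runMax (-x) (show a ≤ m by omega)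
  rw [walk_neg] at h2
  have h3 : ((b : ℝ) + 1 - a) / m = ((b : ℝ) - a - 1) / m + 2 / m := by ring
  linarith

section Ratio

lemma nonneg_of_continuous {p : ℝ → ℝ} (hp : Continuous p) (h : ∀ ε, 0 < ε → ε < 1 → 0 ≤ p ε) :
    0 ≤ p 0 := by
  have ht : Tendsto p (𝓝[>] 0) (𝓝 (p 0)) := hp.continuousAt.tendsto.mono_left nhdsWithin_le_nhds
  refine ge_of_tendsto ht ?_
  filter_upwards [Ioo_mem_nhdsGT (zero_lt_one (α := ℝ))] with ε hε
  exact h ε hε.1 hε.2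

variable {a b A α m x₀ : ℝ} {ψ : ℝ → ℝ}

lemma integrableOn_of_bdd {F : ℝ → ℝ} (hF : Measurable F) {C : ℝ}
    (hC : ∀ x ∈ Icc a b, |F x| ≤ C) :
    IntegrableOn F (Icc a b) := by
  refine Measure.integrableOn_of_bounded (M := C) (by simp) hF.aestronglyMeasurable ?_
  filter_upwards [ae_restrict_mem measurableSet_Icc] with x hx
  exact hC x hx

lemma integrableOn_comp_mul_exp (hψ : Measurable ψ) (hmax : ∀ x ∈ Icc a b, ψ x ≤ m)
    {Φ : ℝ → ℝ} (hΦ : Continuous Φ) :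
    IntegrableOn (fun x => Φ (max (ψ x) 0) * (A * Real.exp (α * x))) (Icc a b) := by
  obtain ⟨C₁, hC₁⟩ := isCompact_Icc.exists_bound_of_continuousOn
    (s := Icc (0 : ℝ) (max m 0)) hΦ.continuousOn
  obtain ⟨C₂, hC₂⟩ := isCompact_Icc.exists_bound_of_continuousOn (s := Icc a b)
    (f := fun x => A * Real.exp (α * x)) (by fun_prop)
  refine integrableOn_of_bdd (C := C₁ * C₂) (by fun_prop) fun x hx => ?_
  rw [abs_mul]
  have h1 := hC₁ (max (ψ x) 0) ⟨le_max_right _ _, max_le_max_right _ (hmax x hx)⟩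
  have h2 := hC₂ x hx
  rw [Real.norm_eq_abs] at h1 h2
  exact mul_le_mul h1 h2 (abs_nonneg _) ((abs_nonneg _).trans h1)

/-- Dilation inequality for concave functions against a log-affine weight. -/
lemma mul_integral_posPart_le (hA : 0 < A) (hψ : Measurable ψ)
    (hconc : ConcaveOn ℝ (Icc a b) ψ) (hx₀ : x₀ ∈ Icc a b) (hm : ψ x₀ = m) (hm0 : 0 ≤ m)
    (hmax : ∀ x ∈ Icc a b, ψ x ≤ m) :
    2 * m * ∫ x in Icc a b, max (ψ x) 0 * (A * Real.exp (α * x)) ≤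
      (3 + |α| * (b - a)) *
        ∫ x in Icc a b, max (ψ x) 0 ^ 2 * (A * Real.exp (α * x)) := by
  set κ := |α| * (b - a) with hκ
  set I := ∫ x in Icc a b, max (ψ x) 0 * (A * Real.exp (α * x)) with hI
  set J := ∫ x in Icc a b, max (ψ x) 0 ^ 2 * (A * Real.exp (α * x)) with hJ
  have hiI : IntegrableOn (fun x => max (ψ x) 0 * (A * Real.exp (α * x))) (Icc a b) :=
    integrableOn_comp_mul_exp (Φ := id) hψ hmax continuous_id
  have hiJ : IntegrableOn (fun x => max (ψ x) 0 ^ 2 * (A * Real.exp (α * x))) (Icc a b) :=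
    integrableOn_comp_mul_exp (Φ := fun u => u ^ 2) hψ hmax (by fun_prop)
  have hI0 : 0 ≤ I := integral_nonneg fun x => by positivity
  have hJ0 : 0 ≤ J := integral_nonneg fun x => by positivity
  set F : ℝ → ℝ := (Icc a b).indicator fun x => max (ψ x) 0 ^ 2 * (A * Real.exp (α * x)) with hF
  have hF0 : ∀ x, 0 ≤ F x := fun x => indicator_nonneg (fun y _ => by positivity) x
  have hiF : Integrable F := (integrable_indicator_iff measurableSet_Icc).2 hiJ
  have hFJ : ∫ x, F x = J := integral_indicator measurableSet_Icc
  have key : ∀ ε, 0 < ε → ε < 1 →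
      (1 - ε) * ((1 - ε * κ) * ((1 - ε) ^ 2 * J + 2 * (1 - ε) * ε * m * I)) ≤ J := by
    intro ε hε0 hε1
    have hl : 0 < 1 - ε := by linarith
    have hscale : (1 - ε) * ∫ x, F (ε * x₀ + (1 - ε) * x) = J := by
      have h1 := Measure.integral_comp_mul_left (fun x => F (ε * x₀ + x)) (1 - ε)
      have h2 := integral_add_left_eq_self (μ := volume) F (ε * x₀)
      rw [h1, h2, hFJ, abs_of_pos (by positivity), smul_eq_mul]
      field_simp
    have hicomp : Integrable fun x => F (ε * x₀ + (1 - ε) * x) :=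
      (hiF.comp_add_left (ε * x₀)).comp_mul_left' hl.ne'
    have hle : (1 - ε * κ) * ((1 - ε) ^ 2 * J + 2 * (1 - ε) * ε * m * I) ≤
        ∫ x, F (ε * x₀ + (1 - ε) * x) := by
      refine le_trans ?_ (setIntegral_le_integral (s := Icc a b) hicomp
        (.of_forall fun x => hF0 _))
      rw [hI, hJ, ← integral_const_mul, ← integral_const_mul,
        ← integral_add (hiJ.const_mul _) (hiI.const_mul _), ← integral_const_mul]
      refine setIntegral_mono_on (((hiJ.const_mul _).add (hiI.const_mul _)).const_mul _)
        hicomp.integrableOn measurableSet_Icc fun x hx => ?_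
      have hmem : ε * x₀ + (1 - ε) * x ∈ Icc a b :=
        (convex_Icc a b) hx₀ hx hε0.le hl.le (by ring)
      have hc := hconc.2 hx₀ hx hε0.le hl.le (by ring)
      simp only [smul_eq_mul, hm] at hc
      rw [hF, indicator_of_mem hmem]
      have hu : (1 - ε) ^ 2 * max (ψ x) 0 ^ 2 + 2 * (1 - ε) * ε * m * max (ψ x) 0 ≤
          max (ψ (ε * x₀ + (1 - ε) * x)) 0 ^ 2 := by
        rcases le_total (ψ x) 0 with h | h
        · rw [max_eq_right h]; simp only [ne_eq, OfNat.ofNat_ne_zero, not_false_eq_true, zero_pow,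
            mul_zero, add_zero]; positivity
        · rw [max_eq_left h]
          have h1 : 0 ≤ ε * m + (1 - ε) * ψ x := by positivity
          have h2 := pow_le_pow_left₀ h1 (hc.trans (le_max_left _ 0)) 2
          nlinarith [sq_nonneg (ε * m)]
      have he : (1 - ε * κ) * Real.exp (α * x) ≤ Real.exp (α * (ε * x₀ + (1 - ε) * x)) := by
        have h1 : α * (ε * x₀ + (1 - ε) * x) = ε * (α * (x₀ - x)) + α * x := by ring
        rw [h1, Real.exp_add]
        gcongr
        have h2 : -κ ≤ α * (x₀ - x) := by
          have h3 : |α * (x₀ - x)| ≤ κ := by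
            rw [abs_mul, hκ]
            gcongr
            rw [abs_le]
            constructor <;> linarith [hx.1, hx.2, hx₀.1, hx₀.2]
          exact (abs_le.1 h3).1
        have h3 := Real.add_one_le_exp (ε * (α * (x₀ - x)))
        nlinarith
      have hu0 : 0 ≤ (1 - ε) ^ 2 * max (ψ x) 0 ^ 2 + 2 * (1 - ε) * ε * m * max (ψ x) 0 := by
        have : 0 ≤ max (ψ x) 0 := le_max_right _ _
        positivity
      calc _ = ((1 - ε) ^ 2 * max (ψ x) 0 ^ 2 + 2 * (1 - ε) * ε * m * max (ψ x) 0) *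
            (A * ((1 - ε * κ) * Real.exp (α * x))) := by ring
        _ ≤ ((1 - ε) ^ 2 * max (ψ x) 0 ^ 2 + 2 * (1 - ε) * ε * m * max (ψ x) 0) *
            (A * Real.exp (α * (ε * x₀ + (1 - ε) * x))) := by gcongr
        _ ≤ _ := by gcongr
    calc _ ≤ (1 - ε) * ∫ x, F (ε * x₀ + (1 - ε) * x) := by gcongr
      _ = J := hscale
  have hfin := nonneg_of_continuous
    (p := fun ε => ((3 - 3 * ε + ε ^ 2) + κ * (1 - ε) ^ 3) * J -
      2 * (1 - ε) ^ 2 * (1 - ε * κ) * (m * I)) (by fun_prop) fun ε h0 h1 => by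
    have h := key ε h0 h1
    have h2 : ε * (((3 - 3 * ε + ε ^ 2) + κ * (1 - ε) ^ 3) * J -
      2 * (1 - ε) ^ 2 * (1 - ε * κ) * (m * I)) = J - (1 - ε) *
      ((1 - ε * κ) * ((1 - ε) ^ 2 * J + 2 * (1 - ε) * ε * m * I)) := by ring
    exact nonneg_of_mul_nonneg_right (by rw [h2]; linarith) h0
  simp at hfin
  linarith

lemma exp_sub_one_chord {c u : ℝ} (hc : 0 ≤ c) (hcu : c ≤ u) :
    u * (Real.exp c - 1) ≤ c * (Real.exp u - 1) := by
  rcases hc.eq_or_lt with rfl | hc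
  · simp
  have hu : 0 < u := hc.trans_le hcu
  have h := convexOn_exp.2 (mem_univ u) (mem_univ 0) (div_nonneg hc.le hu.le)
    (sub_nonneg.2 ((div_le_one hu).2 hcu)) (by ring)
  simp only [smul_eq_mul, mul_zero, add_zero, Real.exp_zero, mul_one,
    div_mul_cancel₀ c hu.ne'] at h
  have h2 : u * (c / u * Real.exp u + (1 - c / u)) = c * Real.exp u + (u - c) := by
    field_simp
  nlinarith [mul_le_mul_of_nonneg_left h hu.le]

lemma exp_sub_one_mul_ge {c u : ℝ} (hc : 0 < c) (hu : 0 ≤ u) :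
    (Real.exp c - 1) / c * (u * (u - c)) ≤ (Real.exp u - 1) * (u - c) := by
  rw [div_mul_eq_mul_div, div_le_iff₀ hc]
  rcases le_total c u with h | h
  · nlinarith [exp_sub_one_chord hc.le h]
  · nlinarith [exp_sub_one_chord hu h]

lemma mul_integral_exp_sub_one_le (hA : 0 < A) (hab : a ≤ b) (hψ : Measurable ψ)
    (hconc : ConcaveOn ℝ (Icc a b) ψ) (hx₀ : x₀ ∈ Icc a b) (hm : ψ x₀ = m) (hm0 : 0 < m)
    (hmax : ∀ x ∈ Icc a b, ψ x ≤ m) :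
    m * ∫ x in Icc a b, (Real.exp (max (ψ x) 0) - 1) * (A * Real.exp (α * x)) ≤
      ((3 + |α| * (b - a)) / 2) * ∫ x in Icc a b,
        (max (ψ x) 0 * (Real.exp (max (ψ x) 0) - 1)) * (A * Real.exp (α * x)) := by
  have h := mul_integral_posPart_le (α := α) hA hψ hconc hx₀ hm hm0.le hmax
  set R := (3 + |α| * (b - a)) / 2 with hR
  have hR0 : 0 < R := by
    have : 0 ≤ |α| * (b - a) := mul_nonneg (abs_nonneg _) (by linarith)
    rw [hR]; linarith
  set c := m / R with hc
  have hc0 : 0 < c := div_pos hm0 hR0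
  have hcR : c * R = m := div_mul_cancel₀ _ hR0.ne'
  have i1 : IntegrableOn (fun x => max (ψ x) 0 * (A * Real.exp (α * x))) (Icc a b) :=
    integrableOn_comp_mul_exp (Φ := id) hψ hmax continuous_id
  have i2 : IntegrableOn (fun x => max (ψ x) 0 ^ 2 * (A * Real.exp (α * x))) (Icc a b) :=
    integrableOn_comp_mul_exp (Φ := fun u => u ^ 2) hψ hmax (by fun_prop)
  have i3 : IntegrableOn (fun x => (Real.exp (max (ψ x) 0) - 1) * (A * Real.exp (α * x)))
      (Icc a b) :=
    integrableOn_comp_mul_exp (Φ := fun u => Real.exp u - 1) hψ hmax (by fun_prop)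
  have i4 : IntegrableOn (fun x => (max (ψ x) 0 * (Real.exp (max (ψ x) 0) - 1)) *
      (A * Real.exp (α * x))) (Icc a b) :=
    integrableOn_comp_mul_exp (Φ := fun u => u * (Real.exp u - 1)) hψ hmax (by fun_prop)
  set I := ∫ x in Icc a b, max (ψ x) 0 * (A * Real.exp (α * x))
  set J := ∫ x in Icc a b, max (ψ x) 0 ^ 2 * (A * Real.exp (α * x))
  set D := ∫ x in Icc a b, (Real.exp (max (ψ x) 0) - 1) * (A * Real.exp (α * x))
  set Q := ∫ x in Icc a b,
        (max (ψ x) 0 * (Real.exp (max (ψ x) 0) - 1)) * (A * Real.exp (α * x))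
  have hmono : (Real.exp c - 1) / c * (J - c * I) ≤ Q - c * D := by
    rw [← integral_const_mul, ← integral_const_mul, ← integral_sub i2 (i1.const_mul _),
      ← integral_sub i4 (i3.const_mul _), ← integral_const_mul]
    refine setIntegral_mono_on ((i2.sub (i1.const_mul _)).const_mul _)
      (i4.sub (i3.const_mul _)) measurableSet_Icc fun x _ => ?_
    have h1 := exp_sub_one_mul_ge hc0 (le_max_right (ψ x) 0)
    have h2 : 0 ≤ A * Real.exp (α * x) := by positivity
    nlinarith [mul_le_mul_of_nonneg_right h1 h2]
  have hJ : 0 ≤ J - c * I := by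
    have h3 : 2 * m * I ≤ 2 * R * J := by rw [hR]; linarith
    have : R * (c * I) ≤ R * J := by
      have : R * (c * I) = m * I := by rw [← hcR]; ring
      linarith
    linarith [le_of_mul_le_mul_left this hR0]
  have hw : 0 ≤ (Real.exp c - 1) / c :=
    div_nonneg (by linarith [Real.add_one_le_exp c]) hc0.le
  have hQ : c * D ≤ Q := by linarith [mul_nonneg hw hJ]
  calc m * D = R * (c * D) := by rw [← hcR]; ring
    _ ≤ R * Q := by gcongr

end Ratio

section Toolkit

lemma UpperSemicontinuous.mul_of_nonneg {f g : ℝ → ℝ} (hf : UpperSemicontinuous f)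
    (hg : UpperSemicontinuous g) (hf0 : ∀ x, 0 ≤ f x) (hg0 : ∀ x, 0 ≤ g x) :
    UpperSemicontinuous fun x => f x * g x := by
  intro x y hy
  have hc : Tendsto (fun δ : ℝ => (f x + δ) * (g x + δ)) (𝓝[>] 0) (𝓝 ((f x + 0) * (g x + 0))) :=
    ((by fun_prop : Continuous fun δ : ℝ => (f x + δ) * (g x + δ)).tendsto 0).mono_left
      nhdsWithin_le_nhds
  simp only [add_zero] at hc
  obtain ⟨δ, hδ, hδ0⟩ :=
    ((hc.eventually (gt_mem_nhds hy)).and self_mem_nhdsWithin).exists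
  have hδ0 : 0 < δ := hδ0
  filter_upwards [hf x (f x + δ) (by linarith), hg x (g x + δ) (by linarith)] with z h1 h2
  refine lt_of_le_of_lt (mul_le_mul h1.le h2.le (hg0 z) ?_) hδ
  linarith [hf0 x]

lemma UpperSemicontinuous.rpow_const {f : ℝ → ℝ} (hf : UpperSemicontinuous f)
    (hf0 : ∀ x, 0 ≤ f x) {p : ℝ} (hp : 0 ≤ p) :
    UpperSemicontinuous fun x => f x ^ p := by
  have hmono : Monotone fun y : ℝ => (max y 0) ^ p := fun u v h =>
    Real.rpow_le_rpow (le_max_right _ _) (max_le_max_right _ h) hp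
  have hcont : Continuous fun y : ℝ => (max y 0) ^ p :=
    (continuous_id.max continuous_const).rpow_const fun _ => Or.inr hp
  have h := hcont.comp_upperSemicontinuous hf hmono
  have heq : (fun y : ℝ => (max y 0) ^ p) ∘ f = fun x => f x ^ p := by
    funext x
    simp [max_eq_left (hf0 x)]
  rwa [heq] at h

namespace IsLogConcaveFn

variable {f g : ℝ → ℝ}

lemma mul (hf : IsLogConcaveFn f) (hg : IsLogConcaveFn g) :
    IsLogConcaveFn fun x => f x * g x := by
  refine ⟨fun x => mul_nonneg (hf.1 x) (hg.1 x), fun x y t ht => ?_⟩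
  rw [Real.mul_rpow (hf.1 x) (hg.1 x), Real.mul_rpow (hf.1 y) (hg.1 y)]
  calc _ = (f x ^ (1 - t) * f y ^ t) * (g x ^ (1 - t) * g y ^ t) := by ring
    _ ≤ _ := mul_le_mul (hf.2 x y t ht) (hg.2 x y t ht)
      (mul_nonneg (Real.rpow_nonneg (hg.1 x) _) (Real.rpow_nonneg (hg.1 y) _)) (hf.1 _)

lemma rpow_const (hf : IsLogConcaveFn f) {p : ℝ} (hp : 0 ≤ p) :
    IsLogConcaveFn fun x => f x ^ p := by
  refine ⟨fun x => Real.rpow_nonneg (hf.1 x) _, fun x y t ht => ?_⟩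
  have h := Real.rpow_le_rpow
    (mul_nonneg (Real.rpow_nonneg (hf.1 x) _) (Real.rpow_nonneg (hf.1 y) _)) (hf.2 x y t ht) hp
  rwa [Real.mul_rpow (Real.rpow_nonneg (hf.1 x) _) (Real.rpow_nonneg (hf.1 y) _),
    ← Real.rpow_mul (hf.1 x), ← Real.rpow_mul (hf.1 y), mul_comm (1 - t) p, mul_comm t p,
    Real.rpow_mul (hf.1 x), Real.rpow_mul (hf.1 y)] at h

lemma min (hf : IsLogConcaveFn f) (hg : IsLogConcaveFn g) :
    IsLogConcaveFn fun x => min (f x) (g x) := by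
  have h0 : ∀ x, 0 ≤ Min.min (f x) (g x) := fun x => le_min (hf.1 x) (hg.1 x)
  refine ⟨h0, fun x y t ht => le_min ?_ ?_⟩
  · refine le_trans (mul_le_mul ?_ ?_ (Real.rpow_nonneg (h0 y) _) (Real.rpow_nonneg (hf.1 x) _))
      (hf.2 x y t ht)
    · exact Real.rpow_le_rpow (h0 x) (min_le_left _ _) (by linarith [ht.2])
    · exact Real.rpow_le_rpow (h0 y) (min_le_left _ _) ht.1
  · refine le_trans (mul_le_mul ?_ ?_ (Real.rpow_nonneg (h0 y) _) (Real.rpow_nonneg (hg.1 x) _))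
      (hg.2 x y t ht)
    · exact Real.rpow_le_rpow (h0 x) (min_le_right _ _) (by linarith [ht.2])
    · exact Real.rpow_le_rpow (h0 y) (min_le_right _ _) ht.1

lemma indicator_Icc (a b : ℝ) : IsLogConcaveFn ((Icc a b).indicator fun _ => (1 : ℝ)) := by
  have h0 : ∀ x, 0 ≤ (Icc a b).indicator (fun _ => (1 : ℝ)) x :=
    fun x => indicator_nonneg (fun _ _ => zero_le_one) x
  refine ⟨h0, fun x y t ht => ?_⟩
  rcases eq_or_lt_of_le ht.1 with rfl | ht0
  · simp
  rcases eq_or_lt_of_le ht.2 with rfl | ht1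
  · simp
  by_cases hx : x ∈ Icc a b
  · by_cases hy : y ∈ Icc a b
    · have hz := convex_Icc a b hx hy (by linarith : 0 ≤ 1 - t) ht.1 (by ring)
      rw [indicator_of_mem hx, indicator_of_mem hy, indicator_of_mem hz]
      simp
    · rw [indicator_of_notMem hy, Real.zero_rpow ht0.ne', mul_zero]
      exact h0 _
  · rw [indicator_of_notMem hx, Real.zero_rpow (by linarith), zero_mul]
    exact h0 _

lemma mul_exp {A : ℝ} (hA : 0 < A) (α : ℝ) : IsLogConcaveFn fun x => A * Real.exp (α * x) := by
  refine ⟨fun x => by positivity, fun x y t _ => le_of_eq ?_⟩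
  rw [Real.mul_rpow hA.le (Real.exp_pos _).le, Real.mul_rpow hA.le (Real.exp_pos _).le,
    ← Real.exp_mul, ← Real.exp_mul]
  calc _ = (A ^ (1 - t) * A ^ t) * (Real.exp (α * x * (1 - t)) * Real.exp (α * y * t)) := by ring
    _ = _ := by
      rw [← Real.rpow_add hA, ← Real.exp_add]
      simp only [sub_add_cancel, Real.rpow_one, smul_eq_mul]
      ring_nf

lemma pos_of_mem_Icc (hf : IsLogConcaveFn f) {a b x : ℝ} (ha : 0 < f a) (hb : 0 < f b)
    (hx : x ∈ Icc a b) : 0 < f x := by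
  rw [← segment_eq_Icc (hx.1.trans hx.2), segment_eq_image] at hx
  obtain ⟨t, ht, rfl⟩ := hx
  exact lt_of_lt_of_le (mul_pos (Real.rpow_pos_of_pos ha _) (Real.rpow_pos_of_pos hb _))
    (hf.2 a b t ht)

lemma concaveOn_log (hf : IsLogConcaveFn f) {s : Set ℝ} (hs : Convex ℝ s)
    (hpos : ∀ x ∈ s, 0 < f x) : ConcaveOn ℝ s fun x => Real.log (f x) := by
  refine ⟨hs, fun x hx y hy p t hp ht hpt => ?_⟩
  obtain rfl : p = 1 - t := by linarith
  have hx' := hpos x hx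
  have hy' := hpos y hy
  have h := Real.log_le_log (mul_pos (Real.rpow_pos_of_pos hx' _) (Real.rpow_pos_of_pos hy' _))
    (hf.2 x y t ⟨ht, by linarith⟩)
  rwa [Real.log_mul (Real.rpow_pos_of_pos hx' _).ne' (Real.rpow_pos_of_pos hy' _).ne',
    Real.log_rpow hx', Real.log_rpow hy'] at h

end IsLogConcaveFn

end Toolkit

section MLE

lemma sum_elog_of_pos {n : ℕ} {y : Fin n → ℝ} (hy : ∀ i, 0 < y i) :
    ∑ i, elog (y i) = ((∑ i, Real.log (y i) : ℝ) : EReal) := by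
  have h : ∀ s : Finset (Fin n),
      ∑ i ∈ s, elog (y i) = ((∑ i ∈ s, Real.log (y i) : ℝ) : EReal) := by
    intro s
    induction s using Finset.induction_on with
    | empty => simp
    | insert i s his ih =>
      rw [Finset.sum_insert his, Finset.sum_insert his, ih, EReal.coe_add, elog,
        if_neg (not_le.2 (hy i))]
  exact h Finset.univ

lemma sum_elog_eq_bot {n : ℕ} {y : Fin n → ℝ} {i : Fin n} (hi : y i ≤ 0) :
    ∑ i, elog (y i) = ⊥ := by
  rw [← Finset.add_sum_erase _ _ (Finset.mem_univ i), elog, if_pos hi, EReal.bot_add]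

lemma exp_neg_le_quadratic {x : ℝ} (hx : 0 ≤ x) : Real.exp (-x) ≤ 1 - x + x ^ 2 := by
  rw [Real.exp_neg]
  refine inv_le_of_inv_le₀ (by nlinarith [sq_nonneg (x - 1)]) ?_
  refine le_trans ?_ (Real.add_one_le_exp x)
  rw [inv_le_iff_one_le_mul₀ (by nlinarith [sq_nonneg (x - 1)])]
  nlinarith [pow_nonneg hx 3]

lemma IsDensity.integrable {f : ℝ → ℝ} (hf : IsDensity f) : Integrable f := by
  refine ⟨hf.2.1.aestronglyMeasurable, ?_⟩
  rw [hasFiniteIntegral_iff_ofReal (Eventually.of_forall hf.1), hf.2.2]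
  exact ENNReal.one_lt_top

lemma IsDensity.integral_eq_one {f : ℝ → ℝ} (hf : IsDensity f) : ∫ x, f x = 1 := by
  rw [integral_eq_lintegral_of_nonneg_ae (Eventually.of_forall hf.1)
    hf.2.1.aestronglyMeasurable, hf.2.2, ENNReal.toReal_one]

lemma isLCDensity_div_integral {h : ℝ → ℝ} (hlc : IsLogConcaveFn h) (hus : UpperSemicontinuous h)
    (h_int : Integrable h) (hc : 0 < ∫ x, h x) : IsLCDensity fun x => (∫ x, h x)⁻¹ * h x := by
  have hc' : 0 < (∫ x, h x)⁻¹ := inv_pos.2 hc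
  have h0 : ∀ x, 0 ≤ (∫ x, h x)⁻¹ * h x := fun x => mul_nonneg hc'.le (hlc.1 x)
  refine ⟨⟨h0, hus.measurable.const_mul _, ?_⟩, ?_, ?_⟩
  · rw [← ofReal_integral_eq_lintegral_ofReal (h_int.const_mul _) (Eventually.of_forall h0),
      integral_const_mul, inv_mul_cancel₀ hc.ne', ENNReal.ofReal_one]
  · exact upperSemicontinuous_const.mul_of_nonneg hus (fun _ => hc'.le) hlc.1
  · have h1 := (IsLogConcaveFn.mul_exp hc' 0).mul hlc
    simpa using h1

variable {n : ℕ} {xs : Fin n → ℝ} {g : ℝ → ℝ}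

lemma IsMLE1.pos (hg : IsMLE1 xs g) {f : ℝ → ℝ} (hf : IsLCDensity f) (hpos : ∀ i, 0 < f (xs i))
    (i : Fin n) : 0 < g (xs i) := by
  by_contra! hi
  have h := hg.2 f hf
  rw [sum_elog_of_pos hpos, sum_elog_eq_bot (y := fun i => g (xs i)) hi, le_bot_iff] at h
  exact EReal.coe_ne_bot _ h

lemma IsMLE1.sum_log_le (hg : IsMLE1 xs g) {h : ℝ → ℝ} (hlc : IsLogConcaveFn h)
    (hus : UpperSemicontinuous h) (h_int : Integrable h) (hc : 0 < ∫ x, h x)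
    (hpos : ∀ i, 0 < h (xs i)) :
    ∑ i, Real.log (h (xs i)) ≤ ∑ i, Real.log (g (xs i)) + n * Real.log (∫ x, h x) := by
  have hden := isLCDensity_div_integral hlc hus h_int hc
  have hpos' : ∀ i, 0 < (∫ x, h x)⁻¹ * h (xs i) := fun i => mul_pos (inv_pos.2 hc) (hpos i)
  have hgpos := hg.pos hden hpos'
  have h1 := hg.2 _ hden
  rw [sum_elog_of_pos hpos', sum_elog_of_pos hgpos, EReal.coe_le_coe_iff] at h1
  have h2 : ∑ i, Real.log ((∫ x, h x)⁻¹ * h (xs i)) =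
      ∑ i, Real.log (h (xs i)) - n * Real.log (∫ x, h x) := by
    have h3 : ∀ i, Real.log ((∫ x, h x)⁻¹ * h (xs i)) =
        Real.log (h (xs i)) - Real.log (∫ x, h x) := fun i => by
      rw [Real.log_mul (inv_pos.2 hc).ne' (hpos i).ne', Real.log_inv]
      ring
    simp only [h3, Finset.sum_sub_distrib, Finset.sum_const, Finset.card_univ, Fintype.card_fin,
      nsmul_eq_mul]
  linarith

variable {a b A α : ℝ}

/-- First-order optimality conditions of the log-concave maximum likelihood estimator `g` in
the direction of the positive part of `log g - log q`, where `q` is log-affine. -/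
lemma IsMLE1.optimality (hn : 0 < n) (hg : IsMLE1 xs g) (hA : 0 < A) (hab : a < b)
    (hxs : ∀ i, xs i ∈ Icc a b) (hgpos : ∀ x ∈ Icc a b, 0 < g x) {m : ℝ} {ψ : ℝ → ℝ}
    (hψdef : ∀ x, ψ x = Real.log (g x) - Real.log A - α * x) (hψ : Measurable ψ)
    (hmax : ∀ x ∈ Icc a b, ψ x ≤ m) :
    (∫ x in Icc a b, g x) = 1 ∧
      ∫ x in Icc a b, (max (ψ x) 0 * Real.exp (max (ψ x) 0)) * (A * Real.exp (α * x)) ≤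
        (1 / (n : ℝ)) * ∑ i, max (ψ (xs i)) 0 := by
  set u : ℝ → ℝ := fun x => max (ψ x) 0 with hu
  have hu0 : ∀ x, 0 ≤ u x := fun x => le_max_right _ _
  obtain ⟨⟨hgd, hgus, hglc⟩, -⟩ := id hg
  have hgint := hgd.integrable
  have hq0 : ∀ x, 0 < A * Real.exp (α * x) := fun x => by positivity
  have hgψ : ∀ x ∈ Icc a b, g x = Real.exp (ψ x) * (A * Real.exp (α * x)) := by
    intro x hx
    rw [hψdef, Real.exp_sub, Real.exp_sub, Real.exp_log (hgpos x hx), Real.exp_log hA]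
    field_simp
  have hug : ∀ x ∈ Icc a b, u x * g x =
      (max (ψ x) 0 * Real.exp (max (ψ x) 0)) * (A * Real.exp (α * x)) := by
    intro x hx
    rw [hgψ x hx]
    rcases le_total (ψ x) 0 with h | h
    · simp [hu, max_eq_right h]
    · simp [hu, max_eq_left h, mul_assoc]
  have hu2g : ∀ x ∈ Icc a b, u x ^ 2 * g x =
      (max (ψ x) 0 ^ 2 * Real.exp (max (ψ x) 0)) * (A * Real.exp (α * x)) := by
    intro x hx
    rw [pow_two, mul_assoc, hug x hx]
    simp only [hu]
    ring
  have hi1 : IntegrableOn (fun x => u x * g x) (Icc a b) :=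
    (integrableOn_comp_mul_exp (Φ := fun u => u * Real.exp u) hψ hmax (by fun_prop)).congr_fun
      (fun x hx => (hug x hx).symm) measurableSet_Icc
  have hi2 : IntegrableOn (fun x => u x ^ 2 * g x) (Icc a b) :=
    (integrableOn_comp_mul_exp (Φ := fun u => u ^ 2 * Real.exp u) hψ hmax
      (by fun_prop)).congr_fun (fun x hx => (hu2g x hx).symm) measurableSet_Icc
  have hi0 : IntegrableOn g (Icc a b) := hgint.integrableOn
  rw [← setIntegral_congr_fun measurableSet_Icc hug]
  set G := ∫ x in Icc a b, g x with hG
  set U := ∫ x in Icc a b, u x * g x with hU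
  set V := ∫ x in Icc a b, u x ^ 2 * g x with hV
  set P := (1 / (n : ℝ)) * ∑ i, u (xs i) with hP
  have hn' : (0 : ℝ) < n := by exact_mod_cast hn
  have key : ∀ ε, 0 < ε → ε < 1 → 0 ≤ G - 1 - ε * U + ε ^ 2 * V + ε * P := by
    intro ε hε0 hε1
    set h : ℝ → ℝ := fun x => (Icc a b).indicator (fun _ => (1 : ℝ)) x *
      min (g x) (g x ^ (1 - ε) * (A * Real.exp (α * x)) ^ ε) with hh
    have hlc : IsLogConcaveFn h := (IsLogConcaveFn.indicator_Icc a b).mul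
      (hglc.min ((hglc.rpow_const (by linarith)).mul
        ((IsLogConcaveFn.mul_exp hA α).rpow_const hε0.le)))
    have hqε : UpperSemicontinuous fun x : ℝ => (A * Real.exp (α * x)) ^ ε :=
      UpperSemicontinuous.rpow_const
        (by fun_prop : Continuous fun x : ℝ => A * Real.exp (α * x)).upperSemicontinuous
        (fun x => (hq0 x).le) hε0.le
    have hus : UpperSemicontinuous h := by
      refine UpperSemicontinuous.mul_of_nonneg
        (isClosed_Icc.upperSemicontinuous_indicator zero_le_one) (hgus.inf ?_)
        (IsLogConcaveFn.indicator_Icc a b).1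
        (hglc.min ((hglc.rpow_const (by linarith)).mul
        ((IsLogConcaveFn.mul_exp hA α).rpow_const hε0.le))).1
      exact UpperSemicontinuous.mul_of_nonneg (hgus.rpow_const hglc.1 (by linarith)) hqε
        (fun x => Real.rpow_nonneg (hglc.1 x) _) (fun x => Real.rpow_nonneg (hq0 x).le _)
    have hval : ∀ x ∈ Icc a b, h x = g x * Real.exp (-(ε * u x)) := by
      intro x hx
      have h1 : g x ^ (1 - ε) * (A * Real.exp (α * x)) ^ ε = g x * Real.exp (-(ε * ψ x)) := by
        have hgx := hgpos x hx
        rw [Real.rpow_def_of_pos hgx, Real.rpow_def_of_pos (hq0 x), ← Real.exp_add,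
          Real.log_mul hA.ne' (Real.exp_pos _).ne', Real.log_exp, hψdef]
        nth_rewrite 2 [← Real.exp_log hgx]
        rw [← Real.exp_add]
        ring_nf
      simp only [hh, indicator_of_mem hx, one_mul, h1, hu]
      rcases le_total (ψ x) 0 with h2 | h2
      · rw [max_eq_right h2, mul_zero, neg_zero, Real.exp_zero, mul_one]
        refine min_eq_left (le_mul_of_one_le_right (hglc.1 x) (Real.one_le_exp ?_))
        nlinarith
      · rw [max_eq_left h2]
        refine min_eq_right (mul_le_of_le_one_right (hglc.1 x) (Real.exp_le_one_iff.2 ?_))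
        nlinarith
    have hout : ∀ x, x ∉ Icc a b → h x = 0 := fun x hx => by
      simp only [hh, indicator_of_notMem hx, zero_mul]
    have hle : ∀ x, h x ≤ g x := by
      intro x
      by_cases hx : x ∈ Icc a b
      · simp only [hh, indicator_of_mem hx, one_mul]
        exact min_le_left _ _
      · rw [hout x hx]
        exact hglc.1 x
    have h_int : Integrable h := by
      refine hgint.mono' hus.measurable.aestronglyMeasurable (Eventually.of_forall fun x => ?_)
      rw [Real.norm_eq_abs, abs_of_nonneg (hlc.1 x)]
      exact hle x
    have hpos : ∀ x ∈ Icc a b, 0 < h x := fun x hx => by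
      rw [hval x hx]
      exact mul_pos (hgpos x hx) (Real.exp_pos _)
    have hc : 0 < ∫ x, h x := by
      rw [integral_pos_iff_support_of_nonneg hlc.1 h_int]
      refine lt_of_lt_of_le ?_ (measure_mono fun x hx => (hpos x hx).ne' : volume (Icc a b) ≤ _)
      simpa using hab
    have h1 := hg.sum_log_le hlc hus h_int hc fun i => hpos _ (hxs i)
    have h2 : ∀ i, Real.log (h (xs i)) = Real.log (g (xs i)) - ε * u (xs i) := fun i => by
      rw [hval _ (hxs i), Real.log_mul (hgpos _ (hxs i)).ne' (Real.exp_pos _).ne', Real.log_exp]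
      ring
    simp only [h2, Finset.sum_sub_distrib, ← Finset.mul_sum] at h1
    have h3 := Real.log_le_sub_one_of_pos hc
    have h4 : ∫ x, h x ≤ G - ε * U + ε ^ 2 * V := by
      have h5 : ∫ x, h x = ∫ x in Icc a b, h x := by
        rw [← integral_indicator measurableSet_Icc]
        congr 1
        funext x
        by_cases hx : x ∈ Icc a b
        · rw [indicator_of_mem hx]
        · rw [indicator_of_notMem hx, hout x hx]
      have hi3 : IntegrableOn (fun x => g x - ε * (u x * g x)) (Icc a b) :=
        hi0.sub (hi1.const_mul ε)
      have h6 : G - ε * U + ε ^ 2 * V =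
          ∫ x in Icc a b, (g x - ε * (u x * g x) + ε ^ 2 * (u x ^ 2 * g x)) := by
        rw [integral_add hi3 (hi2.const_mul _), integral_sub hi0 (hi1.const_mul ε),
          integral_const_mul, integral_const_mul]
      rw [h5, h6]
      refine setIntegral_mono_on h_int.integrableOn (hi3.add (hi2.const_mul _))
        measurableSet_Icc fun x hx => ?_
      rw [hval x hx]
      have h7 := mul_le_mul_of_nonneg_left
        (exp_neg_le_quadratic (mul_nonneg hε0.le (hu0 x))) (hglc.1 x)
      linarith
    have h8 : n * P = ∑ i, u (xs i) := by
      rw [hP]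
      field_simp
    rw [← h8] at h1
    have h9 : (n : ℝ) * (-(ε * P)) ≤ n * Real.log (∫ x, h x) := by linarith
    have h10 := le_of_mul_le_mul_left h9 hn'
    linarith
  have hG1 : G = 1 := by
    refine le_antisymm ?_ ?_
    · rw [← hgd.integral_eq_one]
      exact setIntegral_le_integral hgint (Eventually.of_forall hglc.1)
    · have h := nonneg_of_continuous (p := fun ε => G - 1 - ε * U + ε ^ 2 * V + ε * P)
        (by fun_prop) key
      simp at h
      exact h
  refine ⟨hG1, ?_⟩
  have h := nonneg_of_continuous (p := fun ε => P - U + ε * V) (by fun_prop) fun ε h0 h1 => by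
    have h2 := key ε h0 h1
    rw [hG1] at h2
    have h3 : 0 ≤ ε * (P - U + ε * V) := by linarith
    exact nonneg_of_mul_nonneg_right h3 h0
  simp at h
  exact h

end MLE

section LayerCake

lemma integral_eq_integral_real_le {μ : Measure ℝ} [IsProbabilityMeasure μ] {v : ℝ → ℝ}
    (hv : Measurable v) (hv0 : ∀ x, 0 ≤ v x) {m : ℝ} (hvm : ∀ x, v x ≤ m) :
    ∫ x, v x ∂μ = ∫ t in Ioc 0 m, μ.real {x | t ≤ v x} := by
  refine Integrable.integral_eq_integral_Ioc_meas_le ?_ (Eventually.of_forall hv0)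
    (Eventually.of_forall hvm)
  refine Integrable.of_bound hv.aestronglyMeasurable m (Eventually.of_forall fun x => ?_)
  rw [Real.norm_eq_abs, abs_of_nonneg (hv0 x)]
  exact hvm x

lemma integrableOn_real_le {μ : Measure ℝ} [IsProbabilityMeasure μ] (v : ℝ → ℝ) (m : ℝ) :
    IntegrableOn (fun t => μ.real {x | t ≤ v x}) (Ioc 0 m) := by
  have hanti : Antitone fun t => μ.real {x | t ≤ v x} := fun s t hst =>
    measureReal_mono fun x (hx : t ≤ v x) => hst.trans hx
  refine Measure.integrableOn_of_bounded (M := 1) (by simp) hanti.measurable.aestronglyMeasurable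
    (Eventually.of_forall fun t => ?_)
  rw [Real.norm_eq_abs, abs_of_nonneg measureReal_nonneg]
  exact measureReal_le_one

/-- If the empirical measure is bounded by `μ` up to `K` on all intervals, then empirical means
of bounded quasi-concave functions are controlled by their `μ`-integrals. -/
lemma empirical_mean_le {μ : Measure ℝ} [IsProbabilityMeasure μ] {n : ℕ} {xs : Fin n → ℝ}
    {K : ℝ} (hK : ∀ I : Set ℝ, I.OrdConnected →
      (1 / (n : ℝ)) * ∑ i, (if xs i ∈ I then (1 : ℝ) else 0) ≤ μ.real I + K)
    {v : ℝ → ℝ} (hv : Measurable v) (hv0 : ∀ x, 0 ≤ v x) {m : ℝ} (hm : 0 ≤ m)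
    (hvm : ∀ x, v x ≤ m) (hlev : ∀ t, 0 < t → {x | t ≤ v x}.OrdConnected) :
    (1 / (n : ℝ)) * ∑ i, v (xs i) ≤ ∫ x, v x ∂μ + m * K := by
  have h1 : ∀ i, v (xs i) = ∫ t in Ioc 0 m, (Measure.dirac (xs i)).real {x | t ≤ v x} := fun i => by
    rw [← integral_eq_integral_real_le hv hv0 hvm, integral_dirac]
  have h2 : (1 / (n : ℝ)) * ∑ i, v (xs i) = ∫ t in Ioc 0 m,
      (1 / (n : ℝ)) * ∑ i, (Measure.dirac (xs i)).real {x | t ≤ v x} := by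
    rw [integral_const_mul, integral_finsetSum _ fun i _ => integrableOn_real_le v m]
    simp only [← h1]
  have h3 : ∫ x, v x ∂μ + m * K = ∫ t in Ioc 0 m, (μ.real {x | t ≤ v x} + K) := by
    rw [integral_add (integrableOn_real_le v m) (by simp), integral_eq_integral_real_le hv hv0 hvm]
    simp [hm]
  rw [h2, h3]
  refine setIntegral_mono_on ((integrable_finsetSum _ fun i _ =>
    integrableOn_real_le v m).const_mul _) ((integrableOn_real_le v m).add (by simp))
    measurableSet_Ioc fun t ht => ?_
  refine le_trans (le_of_eq ?_) (hK _ (hlev t ht.1))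
  congr 1
  refine Finset.sum_congr rfl fun i _ => ?_
  have hms : MeasurableSet {x | t ≤ v x} := measurableSet_le measurable_const hv
  rw [measureReal_def, Measure.dirac_apply' _ hms]
  by_cases hx : xs i ∈ {x | t ≤ v x} <;> simp [hx]

end LayerCake

section Deterministic

lemma IsDensity.isProbabilityMeasure {f : ℝ → ℝ} (hf : IsDensity f) :
    IsProbabilityMeasure (volume.withDensity fun x => ENNReal.ofReal (f x)) :=
  ⟨by rw [withDensity_apply _ MeasurableSet.univ, setLIntegral_univ, hf.2.2]⟩

lemma IsDensity.integral_withDensity {f : ℝ → ℝ} (hf : IsDensity f) (v : ℝ → ℝ) :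
    ∫ x, v x ∂(volume.withDensity fun x => ENNReal.ofReal (f x)) = ∫ x, v x * f x := by
  rw [integral_withDensity_eq_integral_toReal_smul hf.2.1.ennreal_ofReal
    (Eventually.of_forall fun x => ENNReal.ofReal_lt_top)]
  congr 1
  funext x
  rw [ENNReal.toReal_ofReal (hf.1 x), smul_eq_mul, mul_comm]

/-- Deterministic bound for the total variation error of the log-concave maximum likelihood
estimator in terms of the discrepancy `K` of the sample over intervals. -/
lemma IsMLE1.half_integral_abs_sub_le {n : ℕ} (hn : 0 < n) {xs : Fin n → ℝ} {f g : ℝ → ℝ}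
    (hg : IsMLE1 xs g) (hf : IsLCDensity f) {a b A α : ℝ} (hA : 0 < A) (hab : a < b)
    (hxs : ∀ i, xs i ∈ Icc a b) {i j : Fin n} (hi : xs i = a) (hj : xs j = b)
    (hform : ∀ x ∈ Icc a b, f x = A * Real.exp (α * x)) {K : ℝ}
    (hK : ∀ I : Set ℝ, I.OrdConnected → (1 / (n : ℝ)) * ∑ i, (if xs i ∈ I then (1 : ℝ) else 0) ≤
      (volume.withDensity fun x => ENNReal.ofReal (f x)).real I + K) :
    (1 / 2) * ∫ x, |g x - f x| ≤ (3 + |α| * (b - a)) / 2 * K := by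
  have hprob := hf.1.isProbabilityMeasure
  have hK0 : 0 ≤ K := by simpa using hK ∅ ordConnected_empty
  have hq0 : ∀ x, 0 < A * Real.exp (α * x) := fun x => by positivity
  have hgX := hg.pos hf fun i => by rw [hform _ (hxs i)]; exact hq0 _
  have hgpos : ∀ x ∈ Icc a b, 0 < g x := fun x hx =>
    hg.1.2.2.pos_of_mem_Icc (hi ▸ hgX i) (hj ▸ hgX j) hx
  set ψ : ℝ → ℝ := fun x => Real.log (g x) - Real.log A - α * x with hψdef
  have hψ : Measurable ψ := by
    have := hg.1.1.2.1
    fun_prop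
  have hconc : ConcaveOn ℝ (Icc a b) ψ := by
    have h1 := hg.1.2.2.concaveOn_log (convex_Icc a b) hgpos
    refine ⟨convex_Icc a b, fun x hx y hy p t hp ht hpt => ?_⟩
    have h2 := h1.2 hx hy hp ht hpt
    simp only [hψdef, smul_eq_mul] at h2 ⊢
    have h3 : p * Real.log A + t * Real.log A = Real.log A := by rw [← add_mul, hpt, one_mul]
    linarith
  obtain ⟨x₀, hx₀, hmax⟩ : ∃ x₀ ∈ Icc a b, ∀ x ∈ Icc a b, ψ x ≤ ψ x₀ := by
    have hus : UpperSemicontinuous fun x => g x * Real.exp (-(α * x)) :=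
      hg.1.2.1.mul_of_nonneg
        (by fun_prop : Continuous fun x : ℝ => Real.exp (-(α * x))).upperSemicontinuous
        hg.1.1.1 fun x => (Real.exp_pos _).le
    obtain ⟨x₀, hx₀, h⟩ := (hus.upperSemicontinuousOn (Icc a b)).exists_isMaxOn
      ⟨a, left_mem_Icc.2 hab.le⟩ isCompact_Icc
    refine ⟨x₀, hx₀, fun x hx => ?_⟩
    have h1 := Real.log_le_log (mul_pos (hgpos x hx) (Real.exp_pos _)) (h hx)
    rw [Real.log_mul (hgpos x hx).ne' (Real.exp_pos _).ne',
      Real.log_mul (hgpos _ hx₀).ne' (Real.exp_pos _).ne', Real.log_exp, Real.log_exp] at h1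
    simp only [hψdef]
    linarith
  obtain ⟨hG, hU⟩ := hg.optimality hn hA hab hxs hgpos (fun x => rfl) hψ hmax
  set m := ψ x₀ with hm
  have hiW : IntegrableOn (fun x => (Real.exp (max (ψ x) 0) - 1) * (A * Real.exp (α * x)))
      (Icc a b) :=
    integrableOn_comp_mul_exp (Φ := fun u => Real.exp u - 1) hψ hmax (by fun_prop)
  set W := ∫ x in Icc a b, (Real.exp (max (ψ x) 0) - 1) * (A * Real.exp (α * x)) with hW
  have hκ : 0 ≤ 3 + |α| * (b - a) := by
    have : 0 ≤ |α| * (b - a) := mul_nonneg (abs_nonneg _) (by linarith)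
    linarith
  have hWle : W ≤ (3 + |α| * (b - a)) / 2 * K := by
    rcases le_or_gt m 0 with hm0 | hm0
    · have : W = 0 := by
        rw [hW, ← integral_zero ℝ ℝ]
        refine setIntegral_congr_fun measurableSet_Icc fun x hx => ?_
        simp [max_eq_right ((hmax x hx).trans hm0)]
      rw [this]
      positivity
    have h1 := mul_integral_exp_sub_one_le hA hab.le hψ hconc hx₀ hm.symm hm0 hmax (α := α)
    set v : ℝ → ℝ := (Icc a b).indicator fun x => max (ψ x) 0 with hv
    have h2 : (1 / (n : ℝ)) * ∑ i, v (xs i) ≤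
        ∫ x, v x ∂(volume.withDensity fun x => ENNReal.ofReal (f x)) + m * K := by
      refine empirical_mean_le hK ((hψ.max measurable_const).indicator measurableSet_Icc)
        (fun x => indicator_nonneg (fun y _ => le_max_right _ _) x) hm0.le (fun x => ?_)
        fun t ht => ?_
      · by_cases hx : x ∈ Icc a b
        · rw [indicator_of_mem hx]
          exact max_le (hmax x hx) hm0.le
        · rw [indicator_of_notMem hx]
          exact hm0.le
      · have h3 : {x | t ≤ v x} = {x ∈ Icc a b | t ≤ ψ x} := by
          ext x
          by_cases hx : x ∈ Icc a b
          · simp [hv, ht, hx.1, hx.2]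
          · simp only [hv, Set.mem_ofPred_eq, indicator_of_notMem hx, hx, false_and, iff_false]
            linarith
        rw [h3]
        exact (hconc.convex_ge t).ordConnected
    have h3 : ∫ x, v x ∂(volume.withDensity fun x => ENNReal.ofReal (f x)) =
        ∫ x in Icc a b, max (ψ x) 0 * (A * Real.exp (α * x)) := by
      rw [hf.1.integral_withDensity, ← integral_indicator measurableSet_Icc]
      congr 1
      funext x
      by_cases hx : x ∈ Icc a b
      · simp only [hv, indicator_of_mem hx, hform x hx]
      · simp only [hv, indicator_of_notMem hx, zero_mul]
    have h4 : ∑ i, v (xs i) = ∑ i, max (ψ (xs i)) 0 :=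
      Finset.sum_congr rfl fun i _ => by rw [hv, indicator_of_mem (hxs i)]
    rw [h3, h4] at h2
    have hi1 : IntegrableOn (fun x => (max (ψ x) 0 * Real.exp (max (ψ x) 0)) *
        (A * Real.exp (α * x))) (Icc a b) :=
      integrableOn_comp_mul_exp (Φ := fun u => u * Real.exp u) hψ hmax (by fun_prop)
    have hi2 : IntegrableOn (fun x => max (ψ x) 0 * (A * Real.exp (α * x))) (Icc a b) :=
      integrableOn_comp_mul_exp (Φ := id) hψ hmax continuous_id
    have h5 : ∫ x in Icc a b, (max (ψ x) 0 * (Real.exp (max (ψ x) 0) - 1)) *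
        (A * Real.exp (α * x)) = (∫ x in Icc a b, (max (ψ x) 0 * Real.exp (max (ψ x) 0)) *
        (A * Real.exp (α * x))) - ∫ x in Icc a b, max (ψ x) 0 * (A * Real.exp (α * x)) := by
      rw [← integral_sub hi1 hi2]
      congr 1
      funext x
      ring
    rw [h5] at h1
    refine le_of_mul_le_mul_left (h1.trans ?_) hm0
    calc _ ≤ (3 + |α| * (b - a)) / 2 * (m * K) :=
          mul_le_mul_of_nonneg_left (by linarith) (by positivity)
      _ = _ := by ring
  refine le_trans ?_ hWle
  have hgi := hg.1.1.integrable
  have hfi := hf.1.integrable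
  have hgf : Integrable fun x => g x - f x := hgi.sub hfi
  have hiD : Integrable fun x => max (g x - f x) 0 := hgf.pos_part
  have h1 : ∫ x, |g x - f x| = 2 * ∫ x, max (g x - f x) 0 := by
    have h2 : ∀ x, |g x - f x| = 2 * max (g x - f x) 0 - (g x - f x) := fun x => by
      rcases le_total (g x - f x) 0 with h | h
      · rw [max_eq_right h, abs_of_nonpos h]
        ring
      · rw [max_eq_left h, abs_of_nonneg h]
        ring
    simp only [h2]
    rw [integral_sub (hiD.const_mul 2) hgf, integral_const_mul, integral_sub hgi hfi,
      hg.1.1.integral_eq_one, hf.1.integral_eq_one]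
    ring
  have hiW' := (integrable_indicator_iff measurableSet_Icc).2 hiW
  have hgI : Integrable ((Icc a b).indicator g) := hgi.indicator measurableSet_Icc
  have hgg : Integrable fun x => g x - (Icc a b).indicator g x := hgi.sub hgI
  have h2 : ∫ x, max (g x - f x) 0 ≤ W := by
    have h3 : W = ∫ x, ((Icc a b).indicator (fun x => (Real.exp (max (ψ x) 0) - 1) *
        (A * Real.exp (α * x))) x + (g x - (Icc a b).indicator g x)) := by
      rw [integral_add hiW' hgg, integral_sub hgi hgI, hg.1.1.integral_eq_one,
        integral_indicator measurableSet_Icc, integral_indicator measurableSet_Icc, hG]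
      ring
    rw [h3]
    refine integral_mono hiD (hiW'.add hgg) fun x => ?_
    by_cases hx : x ∈ Icc a b
    · simp only [indicator_of_mem hx, sub_self, add_zero, hform x hx]
      have h4 : g x = Real.exp (ψ x) * (A * Real.exp (α * x)) := by
        simp only [hψdef]
        rw [Real.exp_sub, Real.exp_sub, Real.exp_log (hgpos x hx), Real.exp_log hA]
        field_simp
      have h5 : Real.exp (ψ x) ≤ Real.exp (max (ψ x) 0) := Real.exp_le_exp.2 (le_max_left _ _)
      have h6 : 1 ≤ Real.exp (max (ψ x) 0) := Real.one_le_exp (le_max_right _ _)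
      refine max_le ?_ (mul_nonneg (by linarith) (hq0 x).le)
      rw [h4, sub_mul, one_mul]
      exact sub_le_sub_right (mul_le_mul_of_nonneg_right h5 (hq0 x).le) _
    · simp only [indicator_of_notMem hx, zero_add, sub_zero]
      exact max_le (by linarith [hf.1.1 x]) (hg.1.1.1 x)
  linarith

end Deterministic

section Numeric

lemma nonneg_of_hasDerivAt_nonneg {F F' : ℝ → ℝ} (h0 : 0 ≤ F 0) (hF : ∀ x, HasDerivAt F (F' x) x)
    (hF' : ∀ x, 0 ≤ x → 0 ≤ F' x) {x : ℝ} (hx : 0 ≤ x) : 0 ≤ F x := by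
  refine h0.trans (monotoneOn_of_hasDerivWithinAt_nonneg (convex_Ici 0)
    (fun y _ => (hF y).continuousAt.continuousWithinAt) (f' := F')
    (fun y _ => (hF y).hasDerivWithinAt) (fun y hy => hF' y ?_) self_mem_Ici hx hx)
  rw [interior_Ici] at hy
  exact hy.le

lemma two_sub_mul_exp_le (x : ℝ) : (2 - x) * Real.exp x ≤ 3 := by
  have h1 := Real.add_one_le_exp (1 - x)
  have h2 : (2 - x) * Real.exp x ≤ Real.exp (1 - x) * Real.exp x :=
    mul_le_mul_of_nonneg_right (by linarith) (Real.exp_pos x).le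
  rw [← Real.exp_add, sub_add_cancel] at h2
  linarith [Real.exp_one_lt_d9]

lemma three_add_le_two_mul_rhoFn {x : ℝ} (hx : 0 ≤ x) : 3 + x ≤ 2 * rhoFn x := by
  rcases hx.eq_or_lt with rfl | hx0
  · norm_num [rhoFn]
  have hexp : ∀ y : ℝ, HasDerivAt Real.exp (Real.exp y) y := Real.hasDerivAt_exp
  have hsq : ∀ y : ℝ, HasDerivAt (fun y : ℝ => y ^ 2) (2 * y) y := fun y => by
    simpa using hasDerivAt_pow 2 y
  have hcu : ∀ y : ℝ, HasDerivAt (fun y : ℝ => y ^ 3) (3 * y ^ 2) y := fun y => by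
    simpa using hasDerivAt_pow 3 y
  have hlin : ∀ (c d : ℝ) (y : ℝ), HasDerivAt (fun y : ℝ => c * y + d) c y := fun c d y => by
    simpa using ((hasDerivAt_id y).const_mul c).add_const d
  have h2 : ∀ y : ℝ, 0 ≤ y → 0 ≤ Real.exp y * (2 * y + -6) + (6 * y + 6) := fun y hy =>
    nonneg_of_hasDerivAt_nonneg (F := fun y => Real.exp y * (2 * y + -6) + (6 * y + 6))
      (by norm_num) (fun y => ((hexp y).mul (hlin 2 (-6) y)).add (hlin 6 6 y))
      (fun y _ => by nlinarith [two_sub_mul_exp_le y]) hy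
  have h1 : ∀ y : ℝ, 0 ≤ y → 0 ≤ Real.exp y * (2 * y + -8) + (3 * y ^ 2 + (6 * y + 8)) :=
    fun y hy =>
    nonneg_of_hasDerivAt_nonneg
      (F := fun y => Real.exp y * (2 * y + -8) + (3 * y ^ 2 + (6 * y + 8)))
      (by norm_num) (fun y => ((hexp y).mul (hlin 2 (-8) y)).add
        (((hsq y).const_mul 3).add (hlin 6 8 y))) (fun y hy => by nlinarith [h2 y hy]) hy
  have h0 : ∀ y : ℝ, 0 ≤ y →
      0 ≤ Real.exp y * (2 * y + -10) + (y ^ 3 + (3 * y ^ 2 + (8 * y + 10))) :=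
    fun y hy =>
    nonneg_of_hasDerivAt_nonneg
      (F := fun y => Real.exp y * (2 * y + -10) + (y ^ 3 + (3 * y ^ 2 + (8 * y + 10))))
      (by norm_num) (fun y => ((hexp y).mul (hlin 2 (-10) y)).add
        ((hcu y).add (((hsq y).const_mul 3).add (hlin 8 10 y))))
      (fun y hy => by nlinarith [h1 y hy]) hy
  have hden : 0 < 2 * Real.exp x - 2 - 2 * x - x ^ 2 := by
    have h := Real.sum_le_exp_of_nonneg hx 4
    simp [Finset.sum_range_succ, Nat.factorial] at h
    nlinarith [pow_pos hx0 3]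
  rw [rhoFn, if_neg hx0.ne', mul_div_assoc', le_div_iff₀ hden]
  nlinarith [h0 x hx]

lemma log_bound {n : ℕ} (hn : 5 ≤ n) :
    (3 + 2 * Real.log n) / √n + n * Real.exp (-(2 * Real.log n)) ≤ 6 * Real.log n / √n := by
  have hn5 : (5 : ℝ) ≤ n := by exact_mod_cast hn
  have hn0 : (0 : ℝ) < n := by linarith
  have hlog : 1 ≤ Real.log n := by
    rw [Real.le_log_iff_exp_le hn0]
    linarith [Real.exp_one_lt_d9]
  have hsq : 0 < √(n : ℝ) := Real.sqrt_pos.2 hn0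
  have hs1 : 1 ≤ √(n : ℝ) := Real.one_le_sqrt.2 (by linarith)
  have hexp : n * Real.exp (-(2 * Real.log n)) = 1 / (√n * √n) := by
    rw [Real.mul_self_sqrt hn0.le, two_mul, neg_add, Real.exp_add, Real.exp_neg, Real.exp_log hn0]
    field_simp
  have h1 : 1 / (√(n : ℝ) * √n) ≤ 1 / √n := by
    apply one_div_le_one_div_of_le hsq
    nlinarith
  rw [hexp]
  refine (add_le_add_right h1 _).trans ?_
  rw [← add_div]
  exact div_le_div_of_nonneg_right (by linarith) hsq.le

end Numeric

section Assembly

lemma pi_setOf_forall_eq {μ : Measure ℝ} [IsProbabilityMeasure μ] [NullSingletonClass μ] {n : ℕ}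
    (hn : 2 ≤ n) : Measure.pi (fun _ : Fin n => μ) {xs | ∀ i j, xs i = xs j} = 0 := by
  obtain ⟨k, rfl⟩ : ∃ k, n = k + 2 := ⟨n - 2, by omega⟩
  have hmp := measurePreserving_piFinSuccAbove (fun _ : Fin (k + 2) => μ) 0
  have hms : MeasurableSet {p : ℝ × (Fin (k + 1) → ℝ) | p.2 0 = p.1} :=
    measurableSet_eq_fun (by fun_prop) (by fun_prop)
  have hnull : (μ.prod (Measure.pi fun _ : Fin (k + 1) => μ))
      {p : ℝ × (Fin (k + 1) → ℝ) | p.2 0 = p.1} = 0 := by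
    rw [Measure.measure_prod_null hms]
    refine Eventually.of_forall fun x => ?_
    exact Measure.pi_hyperplane (fun _ : Fin (k + 1) => μ) 0 x
  refine measure_mono_null (fun xs hxs => ?_) (hmp.quasiMeasurePreserving.preimage_null hnull)
  exact hxs _ _

lemma lintegral_runMax_bins_le {μ : Measure ℝ} [IsProbabilityMeasure μ] {n m : ℕ} (hn : 0 < n)
    (hm : 0 < m) {bin : ℝ → Fin m} (hmono : Monotone bin)
    (hbin : ∀ k ≤ m, μ.real {x | (bin x : ℕ) < k} = (k : ℝ) / m) {c : ℝ} (hc : 0 ≤ c) :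
    ∫⁻ xs, ENNReal.ofReal
        (c * (runMax (incr (bin ∘ xs)) m + runMax (-incr (bin ∘ xs)) m + 2 / m))
        ∂(Measure.pi fun _ : Fin n => μ) ≤ ENNReal.ofReal (c * (2 / √n + 2 / m)) := by
  have hprob : IsProbabilityMeasure (μ.map bin) :=
    Measure.isProbabilityMeasure_map hmono.measurable.aemeasurable
  have hmp : MeasurePreserving (fun xs : Fin n → ℝ => fun i => bin (xs i))
      (Measure.pi fun _ : Fin n => μ) (Measure.pi fun _ : Fin n => μ.map bin) :=
    measurePreserving_pi _ _ fun _ => ⟨hmono.measurable, rfl⟩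
  have h1 := hmp.lintegral_comp (f := fun ω : Fin n → Fin m => ENNReal.ofReal
        (c * (runMax (incr ω) m + runMax (-incr ω) m + 2 / m))) (measurable_of_finite _)
  refine (le_of_eq h1).trans ?_
  rw [← ofReal_integral_eq_lintegral_ofReal .of_finite (Eventually.of_forall fun ω => by
    have := runMax_nonneg (incr ω) m
    have := runMax_nonneg (-incr ω) m
    positivity)]
  refine ENNReal.ofReal_le_ofReal ?_
  rw [integral_const_mul, integral_add .of_finite .of_finite]
  refine mul_le_mul_of_nonneg_left ?_ hc
  refine add_le_add
    (integral_runMax_incr_le _ (measure_bin_eq hm hmono hbin) hn hm) (le_of_eq ?_)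
  simp

lemma half_integral_abs_sub_le_one {f g : ℝ → ℝ} (hf : IsDensity f) (hg : IsDensity g) :
    (1 / 2) * ∫ x, |g x - f x| ≤ 1 := by
  have h1 : ∫ x, |g x - f x| ≤ ∫ x, (g x + f x) := by
    refine integral_mono (hg.integrable.sub hf.integrable).abs (hg.integrable.add hf.integrable)
      fun x => ?_
    refine abs_le.2 ⟨?_, ?_⟩ <;> linarith [hf.1 x, hg.1 x]
  rw [integral_add hg.integrable hf.integrable, hf.integral_eq_one, hg.integral_eq_one] at h1
  linarith

variable {A α : ℝ} {f₀ : ℝ → ℝ} {n : ℕ} {fhat : (Fin n → ℝ) → ℝ → ℝ}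

/-- Risk bound for the log-concave maximum likelihood estimator when the logarithm of the true
density has oscillation at most `L` on its support, apart from an exceptional set `B`. -/
lemma lintegral_half_integral_abs_sub_le (hf₀ : IsLCDensity f₀) (hA : 0 < A)
    (hform : ∀ x, 0 < f₀ x → f₀ x = A * Real.exp (α * x)) (hn : 2 ≤ n)
    (hfhat : ∀ xs : Fin n → ℝ, (∃ i j, xs i ≠ xs j) → IsMLE1 xs (fhat xs))
    {L : ℝ} (hL0 : 0 ≤ L) {B : Set ℝ} (hB : MeasurableSet B)
    (hL : ∀ x y, 0 < f₀ x → 0 < f₀ y → x ∉ B → y ∉ B → |α| * (y - x) ≤ L) :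
    (∫⁻ xs, ENNReal.ofReal ((1 / 2) * ∫ x, |fhat xs x - f₀ x|)
        ∂(Measure.pi fun _ : Fin n => volume.withDensity fun x => ENNReal.ofReal (f₀ x))) ≤
      ENNReal.ofReal ((3 + L) / √n) +
        n * (volume.withDensity fun x => ENNReal.ofReal (f₀ x)) B := by
  have hprob := hf₀.1.isProbabilityMeasure
  set μ := volume.withDensity fun x => ENNReal.ofReal (f₀ x) with hμ
  have hnull : NullSingletonClass μ :=
    ⟨fun x => withDensity_absolutelyContinuous _ _ (measure_singleton x)⟩
  have hS : ∀ᵐ x ∂μ, 0 < f₀ x := by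
    rw [hμ, ae_withDensity_iff hf₀.1.2.1.ennreal_ofReal]
    refine Eventually.of_forall fun x hx => ?_
    rwa [ne_eq, ENNReal.ofReal_eq_zero, not_le] at hx
  have hall : ∀ᵐ xs ∂(Measure.pi fun _ : Fin n => μ), ∀ i, 0 < f₀ (xs i) :=
    ae_all_iff.2 fun i =>
      (measurePreserving_eval (fun _ : Fin n => μ) i).quasiMeasurePreserving.ae hS
  have hneq : ∀ᵐ xs ∂(Measure.pi fun _ : Fin n => μ), ∃ i j, xs i ≠ xs j := by
    have h := pi_setOf_forall_eq (μ := μ) hn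
    rw [ae_iff]
    simpa using h
  have hn0 : 0 < n := by omega
  have hm : ∀ m : ℕ, 0 < m →
      (∫⁻ xs, ENNReal.ofReal ((1 / 2) * ∫ x, |fhat xs x - f₀ x|)
        ∂(Measure.pi fun _ : Fin n => μ)) ≤
      ENNReal.ofReal ((3 + L) / 2 * (2 / √n + 2 / m)) + n * μ B := by
    intro m hm
    obtain ⟨bin, hmono, hbin⟩ := exists_bins μ hm
    set K : (Fin n → ℝ) → ℝ := fun xs =>
      runMax (incr (bin ∘ xs)) m + runMax (-incr (bin ∘ xs)) m + 2 / m with hK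
    have hK0 : ∀ xs, 0 ≤ K xs := fun xs => by
      have := runMax_nonneg (incr (bin ∘ xs)) m
      have := runMax_nonneg (-incr (bin ∘ xs)) m
      positivity
    have hpt : ∀ᵐ xs ∂(Measure.pi fun _ : Fin n => μ),
        ENNReal.ofReal ((1 / 2) * ∫ x, |fhat xs x - f₀ x|) ≤
          ENNReal.ofReal ((3 + L) / 2 * K xs) + ∑ i, B.indicator 1 (xs i) := by
      filter_upwards [hall, hneq] with xs hxs hne
      have hg := hfhat xs hne
      by_cases hbad : ∃ i, xs i ∈ B
      · obtain ⟨i, hi⟩ := hbad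
        refine le_trans ?_ le_add_self
        refine le_trans ?_ (Finset.single_le_sum (fun _ _ => zero_le) (Finset.mem_univ i))
        rw [indicator_of_mem hi, Pi.one_apply, ← ENNReal.ofReal_one]
        exact ENNReal.ofReal_le_ofReal (half_integral_abs_sub_le_one hf₀.1 hg.1.1)
      push Not at hbad
      refine le_trans ?_ le_self_add
      refine ENNReal.ofReal_le_ofReal ?_
      have : Nonempty (Fin n) := ⟨⟨0, hn0⟩⟩
      obtain ⟨i, hi⟩ := Finite.exists_min xs
      obtain ⟨j, hj⟩ := Finite.exists_max xs
      have hij : xs i < xs j := by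
        obtain ⟨k, l, hkl⟩ := hne
        refine lt_of_le_of_ne (hi j) fun h => hkl ?_
        exact le_antisymm ((hj k).trans (h ▸ hi l)) ((hj l).trans (h ▸ hi k))
      refine (hg.half_integral_abs_sub_le hn0 hf₀ hA hij (fun k => ⟨hi k, hj k⟩) rfl rfl
        (fun x hx => hform x (hf₀.2.2.pos_of_mem_Icc (hxs i) (hxs j) hx))
        fun I hI => empirical_interval_le hn0 hm hmono hbin xs hI).trans ?_
      refine mul_le_mul_of_nonneg_right ?_ (hK0 xs)
      linarith [hL _ _ (hxs i) (hxs j) (hbad i) (hbad j)]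
    refine (lintegral_mono_ae hpt).trans ?_
    have hmeas : ∀ i, Measurable fun xs : Fin n → ℝ => B.indicator (1 : ℝ → ℝ≥0∞) (xs i) :=
      fun i => (measurable_one.indicator hB).comp (measurable_pi_apply i)
    rw [lintegral_add_right _ (Finset.measurable_sum _ fun i _ => hmeas i)]
    refine add_le_add (lintegral_runMax_bins_le hn0 hm hmono hbin (by linarith)) (le_of_eq ?_)
    rw [lintegral_finsetSum _ fun i _ => hmeas i]
    have h1 : ∀ i, ∫⁻ xs, B.indicator (1 : ℝ → ℝ≥0∞) (xs i) ∂(Measure.pi fun _ : Fin n => μ) =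
        μ B := fun i => by
      rw [(measurePreserving_eval (fun _ : Fin n => μ) i).lintegral_comp
        (measurable_one.indicator hB), lintegral_indicator_one hB]
    simp [h1]
  have hlim : Tendsto (fun m : ℕ => ENNReal.ofReal ((3 + L) / 2 * (2 / √n + 2 / m)) + n * μ B)
      atTop (𝓝 (ENNReal.ofReal ((3 + L) / 2 * (2 / √n + 0)) + n * μ B)) :=
    (ENNReal.tendsto_ofReal (((tendsto_const_div_atTop_nhds_zero_nat 2).const_add _).const_mul
      _)).add_const _
  have h := ge_of_tendsto hlim ((eventually_gt_atTop 0).mono hm)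
  refine h.trans (le_of_eq ?_)
  congr 2
  ring

/-- The set of points of the support that stay in the support when shifted so that the
log-affine density grows by the factor `exp y` has probability at most `exp (-y)`. -/
lemma withDensity_shift_le (hf₀ : IsDensity f₀)
    (hform : ∀ x, 0 < f₀ x → f₀ x = A * Real.exp (α * x)) (hα : α ≠ 0) (y : ℝ) :
    (volume.withDensity fun x => ENNReal.ofReal (f₀ x)) {x | 0 < f₀ x ∧ 0 < f₀ (x + y / α)} ≤
      ENNReal.ofReal (Real.exp (-y)) := by
  have hms : MeasurableSet {x | 0 < f₀ x ∧ 0 < f₀ (x + y / α)} :=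
    (measurableSet_lt measurable_const hf₀.2.1).inter
      (measurableSet_lt measurable_const (hf₀.2.1.comp (measurable_add_const _)))
  rw [withDensity_apply _ hms]
  calc _ ≤ ∫⁻ x in {x | 0 < f₀ x ∧ 0 < f₀ (x + y / α)},
        ENNReal.ofReal (Real.exp (-y)) * ENNReal.ofReal (f₀ (x + y / α)) := by
        refine setLIntegral_mono' hms fun x hx => le_of_eq ?_
        rw [← ENNReal.ofReal_mul (Real.exp_pos _).le, hform _ hx.1, hform _ hx.2, mul_left_comm,
          ← Real.exp_add]
        congr 3
        field_simp
        ring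
    _ ≤ ∫⁻ x, ENNReal.ofReal (Real.exp (-y)) * ENNReal.ofReal (f₀ (x + y / α)) :=
        setLIntegral_le_lintegral _ _
    _ = _ := by
        rw [lintegral_const_mul' _ _ ENNReal.ofReal_ne_top,
          lintegral_add_right_eq_self (fun x => ENNReal.ofReal (f₀ x)), hf₀.2.2, mul_one]

end Assembly

/-- Adaptation of the log-concave MLE to true densities `f₀ = f_{α,s₁,s₂} ∈ F¹` whose
logarithm is affine on its support interval: the expected total variation error is at
most `min{2ρ(|κ*|), 6 log n} / √n`. -/
theorem statement18 (α : ℝ) (s₁ s₂ : EReal) (hs : s₁ < s₂)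
    (hs₁ : s₁ ≠ ⊤) (hs₂ : s₂ ≠ ⊥)
    (hbot : s₁ = ⊥ → 0 < α) (htop : s₂ = ⊤ → α < 0)
    (f₀ : ℝ → ℝ) (hf₀ : IsLCDensity f₀)
    (A : ℝ) (hA : 0 < A)
    (hform : ∀ x : ℝ,
      f₀ x = if s₁ ≤ (x : EReal) ∧ (x : EReal) ≤ s₂ then A * Real.exp (α * x) else 0)
    (n : ℕ) (hn : 5 ≤ n)
    (fhat : (Fin n → ℝ) → ℝ → ℝ)
    (hfhat : ∀ xs : Fin n → ℝ, (∃ i j, xs i ≠ xs j) → IsMLE1 xs (fhat xs)) :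
    (∫⁻ xs, ENNReal.ofReal ((1/2) * ∫ x, |fhat xs x - f₀ x|)
        ∂(Measure.pi fun _ : Fin n =>
            volume.withDensity fun x => ENNReal.ofReal (f₀ x)))
      ≤ ENNReal.ofReal (bound18 α s₁ s₂ n / Real.sqrt n) := by
  have hpos : ∀ x, 0 < f₀ x ↔ s₁ ≤ (x : EReal) ∧ (x : EReal) ≤ s₂ := fun x => by
    rw [hform]
    split_ifs with h
    · exact iff_of_true (by positivity) h
    · exact iff_of_false (lt_irrefl _) h
  have hform' : ∀ x, 0 < f₀ x → f₀ x = A * Real.exp (α * x) := fun x hx => by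
    rw [hform, if_pos ((hpos x).1 hx)]
  have hord : ∀ x y z, 0 < f₀ x → 0 < f₀ y → z ∈ Icc x y → 0 < f₀ z := fun x y z hx hy hz =>
    hf₀.2.2.pos_of_mem_Icc hx hy hz
  have hlogn : 0 < Real.log n := Real.log_pos (by exact_mod_cast (by omega : 1 < n))
  have hsecond : (∫⁻ xs, ENNReal.ofReal ((1/2) * ∫ x, |fhat xs x - f₀ x|)
        ∂(Measure.pi fun _ : Fin n =>
            volume.withDensity fun x => ENNReal.ofReal (f₀ x)))
      ≤ ENNReal.ofReal (6 * Real.log n / Real.sqrt n) := by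
    set y := 2 * Real.log n with hy
    have hy0 : 0 < y := by positivity
    obtain ⟨B, hB, hL, hμB⟩ : ∃ B : Set ℝ, MeasurableSet B ∧
        (∀ x x', 0 < f₀ x → 0 < f₀ x' → x ∉ B → x' ∉ B → |α| * (x' - x) ≤ y) ∧
        (volume.withDensity fun x => ENNReal.ofReal (f₀ x)) B ≤
          ENNReal.ofReal (Real.exp (-y)) := by
      by_cases hα : α = 0
      · exact ⟨∅, MeasurableSet.empty, by simp [hα, hy0.le], by simp⟩
      refine ⟨{x | 0 < f₀ x ∧ 0 < f₀ (x + y / α)},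
        (measurableSet_lt measurable_const hf₀.1.2.1).inter
          (measurableSet_lt measurable_const (hf₀.1.2.1.comp (measurable_add_const _))),
        fun x x' hx hx' hxB hxB' => ?_, withDensity_shift_le hf₀.1 hform' hα y⟩
      by_contra! hlt
      rcases lt_or_gt_of_ne hα with h | h
      · refine hxB' ⟨hx', hord x x' _ hx hx' ⟨?_, ?_⟩⟩
        · rw [abs_of_neg h] at hlt
          have : -y / α ≤ x' - x := by
            rw [div_le_iff_of_neg h]
            linarith
          rw [neg_div] at this
          linarith
        · have := div_neg_of_pos_of_neg hy0 h
          linarith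
      · refine hxB ⟨hx, hord x x' _ hx hx' ⟨?_, ?_⟩⟩
        · have := div_pos hy0 h
          linarith
        · rw [abs_of_pos h] at hlt
          have : y / α ≤ x' - x := by
            rw [div_le_iff₀ h]
            linarith
          linarith
    refine (lintegral_half_integral_abs_sub_le hf₀ hA hform' (by omega) hfhat hy0.le hB hL).trans ?_
    calc _ ≤ ENNReal.ofReal ((3 + y) / √n) + n * ENNReal.ofReal (Real.exp (-y)) := by gcongr
      _ = ENNReal.ofReal ((3 + y) / √n + n * Real.exp (-y)) := by
          rw [ENNReal.ofReal_add (by positivity) (by positivity),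
            ENNReal.ofReal_mul (by positivity), ENNReal.ofReal_natCast]
      _ ≤ _ := ENNReal.ofReal_le_ofReal (log_bound hn)
  unfold bound18
  split_ifs with hκ
  · exact hsecond
  rcases le_total (2 * rhoFn ((((|α| : ℝ) : EReal) * (s₂ - s₁)).toReal)) (6 * Real.log n)
    with h | h
  swap
  · rwa [min_eq_right h]
  rw [min_eq_left h]
  set E := ((|α| : ℝ) : EReal) * (s₂ - s₁) with hE
  have hα0 : (0 : EReal) ≤ ((|α| : ℝ) : EReal) := EReal.coe_nonneg.2 (abs_nonneg α)
  have hL : ∀ x x', 0 < f₀ x → 0 < f₀ x' → |α| * (x' - x) ≤ E.toReal := by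
    intro x x' hx hx'
    have h1 : ((|α| * (x' - x) : ℝ) : EReal) ≤ E := by
      rw [EReal.coe_mul, EReal.coe_sub]
      exact mul_le_mul_of_nonneg_left
        (EReal.sub_le_sub ((hpos x').1 hx').2 ((hpos x).1 hx).1) hα0
    exact EReal.toReal_le_toReal h1 (EReal.coe_ne_bot _) hκ
  have hE0 : 0 ≤ E.toReal :=
    EReal.toReal_nonneg (mul_nonneg hα0 (EReal.sub_nonneg (.inr hs₁) (.inl hs₂) |>.2 hs.le))
  refine (lintegral_half_integral_abs_sub_le hf₀ hA hform' (by omega) hfhat hE0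
    MeasurableSet.empty fun x x' hx hx' _ _ => hL x x' hx hx').trans ?_
  rw [measure_empty, mul_zero, add_zero]
  exact ENNReal.ofReal_le_ofReal
    (div_le_div_of_nonneg_right (three_add_le_two_mul_rhoFn hE0) (Real.sqrt_nonneg _))
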